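/- arXiv:1712.08896 — 9 statements merged into one kernel-verified Lean document; each statement's English description precedes it below -/
import Mathlib

section
/- Let V : ℝⁿ → ℝ be continuous with V(x) > 0 for all x. Let γ : (−∞,0] → ℝⁿ be a C¹ curve with ∫_{−∞}^0 ((1/2)‖γ'(t)‖² + V(γ(t))) dt < ∞, and suppose the energy (1/2)‖γ'(t)‖² − V(γ(t)) is equal to a constant C for all t ≤ 0. Then C = 0. -/
open MeasureTheory Set

/-- A `C¹` curve on `(-∞,0]` with finite total action `∫_{-∞}^0 ((1/2)‖γ'‖² + V(γ)) dt`
and constant energy `(1/2)‖γ'(t)‖² − V(γ(t)) = C` (for a positive potential `V`) must have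
zero energy: `C = 0`. -/
theorem energy_zero_of_finite_action {n : ℕ} (V : EuclideanSpace ℝ (Fin n) → ℝ)
    (hVc : Continuous V) (hVpos : ∀ x, 0 < V x)
    (γ : ℝ → EuclideanSpace ℝ (Fin n)) (hγ : ContDiff ℝ 1 γ)
    (hfin : IntegrableOn
      (fun t => (1/2 : ℝ) * ‖deriv γ t‖ ^ 2 + V (γ t)) (Set.Iic 0))
    (C : ℝ)
    (hC : ∀ t ≤ (0:ℝ), (1/2 : ℝ) * ‖deriv γ t‖ ^ 2 - V (γ t) = C) :
    C = 0 := by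
  have hconst : IntegrableOn (fun _ : ℝ => C) (Set.Iic 0) := by
    refine Integrable.mono' hfin aestronglyMeasurable_const ?_
    filter_upwards [ae_restrict_mem measurableSet_Iic] with t ht
    have hV := hVpos (γ t)
    have hK : 0 ≤ (1/2 : ℝ) * ‖deriv γ t‖ ^ 2 := by positivity
    rw [Real.norm_eq_abs, ← hC t ht, abs_le]
    constructor <;> linarith
  simpa [integrableOn_const_iff] using hconst
end

section
/- For every x ∈ ℝⁿ there exists a C² curve γ : (−∞,0] → ℝⁿ with γ(0) = x such that γ''(t) = ∇V(γ(t)) for all t ≤ 0 and ∫_{−∞}^0 L(γ(t), γ'(t)) dt = F(x); that is, the infinite-horizon minimization problem defining F admits a minimizer, and every such minimizer solves Newton's equation. -/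
open MeasureTheory Set Filter

/-- The mechanical Lagrangian `L(x,v) = (1/2)‖v‖² + V(x)`. -/
noncomputable def lag {n : ℕ} (V : EuclideanSpace ℝ (Fin n) → ℝ)
    (x v : EuclideanSpace ℝ (Fin n)) : ℝ :=
  (1/2 : ℝ) * ‖v‖ ^ 2 + V x

/-- `γ` is absolutely continuous on `[a,b]`, with integrable a.e. derivative `g` there. -/
def IsACOn {n : ℕ} (γ g : ℝ → EuclideanSpace ℝ (Fin n)) (a b : ℝ) : Prop :=
  IntegrableOn g (Set.Icc a b) ∧ ∀ t ∈ Set.Icc a b, γ t = γ a + ∫ u in a..t, g u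

/-- The Lax–Oleinik semigroup
`S_T f(x) = inf { f(γ 0) + ∫₀ᵀ L(γ t, γ' t) dt : γ absolutely continuous, γ T = x }`. -/
noncomputable def laxOleinik {n : ℕ} (V : EuclideanSpace ℝ (Fin n) → ℝ) (T : ℝ)
    (f : EuclideanSpace ℝ (Fin n) → ℝ) (x : EuclideanSpace ℝ (Fin n)) : ℝ :=
  sInf { r : ℝ | ∃ γ g : ℝ → EuclideanSpace ℝ (Fin n), IsACOn γ g 0 T ∧ γ T = x ∧
    r = f (γ 0) + ∫ t in (0:ℝ)..T, lag V (γ t) (g t) }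

/-- `γ` is locally absolutely continuous on `(-∞,0]`, with a.e. derivative `g`. -/
def IsACIic {n : ℕ} (γ g : ℝ → EuclideanSpace ℝ (Fin n)) : Prop :=
  (∀ a : ℝ, a ≤ 0 → IntegrableOn g (Set.Icc a 0)) ∧
  ∀ t : ℝ, t ≤ 0 → γ 0 = γ t + ∫ u in t..(0:ℝ), g u

/-- The weak KAM solution
`F(x) = inf { ∫_{-∞}^0 L(γ t, γ' t) dt : γ locally absolutely continuous on (-∞,0], γ 0 = x }`. -/
noncomputable def weakKAM {n : ℕ} (V : EuclideanSpace ℝ (Fin n) → ℝ)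
    (x : EuclideanSpace ℝ (Fin n)) : ℝ :=
  sInf { r : ℝ | ∃ γ g : ℝ → EuclideanSpace ℝ (Fin n), IsACIic γ g ∧ γ 0 = x ∧
    IntegrableOn (fun t => lag V (γ t) (g t)) (Set.Iic 0) ∧
    r = ∫ t in Set.Iic (0:ℝ), lag V (γ t) (g t) }

open scoped Topology InnerProductSpace

section Curves

variable {E : Type*} [NormedAddCommGroup E]

lemma MeasureTheory.MemLp.intervalIntegrable_of_Iic {g : ℝ → E}
    (hg : MemLp g 2 (volume.restrict (Iic 0))) {a b : ℝ} (ha : a ≤ 0) (hb : b ≤ 0) :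
    IntervalIntegrable g volume a b := by
  rw [intervalIntegrable_iff]
  have hs : uIoc a b ⊆ Iic 0 := fun t ht => (mem_uIoc.1 ht).elim (fun h => h.2.trans hb)
    (fun h => h.2.trans ha)
  have h : MemLp g 2 (volume.restrict (uIoc a b)) :=
    hg.mono_measure (Measure.restrict_mono hs le_rfl)
  have : IsFiniteMeasure (volume.restrict (uIoc a b)) := by rw [uIoc]; infer_instance
  exact h.integrable one_le_two

variable [InnerProductSpace ℝ E]

/-- The curve on `(-∞,0]` with velocity `g` that ends at `x` at time `0`. -/
noncomputable def backwardCurve (x : E) (g : ℝ → E) (t : ℝ) : E := x - ∫ u in t..(0:ℝ), g u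

@[simp] lemma backwardCurve_zero (x : E) (g : ℝ → E) : backwardCurve x g 0 = x := by
  simp [backwardCurve]

lemma continuousOn_backwardCurve (x : E) {g : ℝ → E}
    (hg : ∀ a ≤ 0, IntervalIntegrable g volume a 0) :
    ContinuousOn (backwardCurve x g) (Iic 0) := by
  intro t ht
  have h := intervalIntegral.continuousOn_primitive_interval_left (μ := volume) (f := g)
    (a := t - 1) (b := 0)
    (by rw [uIcc_of_le (by linarith [mem_Iic.1 ht])]
        exact (intervalIntegrable_iff_integrableOn_Icc_of_le (by linarith [mem_Iic.1 ht])).1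
          (hg _ (by linarith [mem_Iic.1 ht])))
  rw [uIcc_of_le (by linarith [mem_Iic.1 ht])] at h
  have h2 : ContinuousWithinAt (backwardCurve x g) (Icc (t - 1) 0) t :=
    (continuousOn_const.sub h) t ⟨by linarith, ht⟩
  refine h2.mono_of_mem_nhdsWithin ?_
  rw [← Ici_inter_Iic, inter_comm]
  exact inter_mem_nhdsWithin _ (Ici_mem_nhds (by linarith))

/-- Integration by parts for the inner product of a `C¹` curve and a primitive of `w`. -/
lemma intervalIntegral_inner_primitive [FiniteDimensional ℝ E] {p q w : ℝ → E} {a b : ℝ}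
    (hp : Continuous p) (hq : ∀ t, HasDerivAt q (p t) t) (hw : IntervalIntegrable w volume a b) :
    ∫ t in a..b, ⟪p t, ∫ u in a..t, w u⟫_ℝ =
      ⟪q b, ∫ u in a..b, w u⟫_ℝ - ∫ t in a..b, ⟪q t, w t⟫_ℝ := by
  let e := stdOrthonormalBasis ℝ E
  have hqc : Continuous q := continuous_iff_continuousAt.2 fun t => (hq t).continuousAt
  have hsub : ∀ t ∈ uIcc a b, IntervalIntegrable w volume a t := fun t ht =>
    hw.mono_set (uIcc_subset_uIcc_left ht)
  have hwi : ∀ i, IntervalIntegrable (fun t => ⟪e i, w t⟫_ℝ) volume a b := fun i =>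
    ⟨hw.1.const_inner (e i), hw.2.const_inner (e i)⟩
  have hprim : ∀ i, ∀ t ∈ uIcc a b, ⟪e i, ∫ u in a..t, w u⟫_ℝ = ∫ u in a..t, ⟪e i, w u⟫_ℝ := by
    intro i t ht
    exact ((innerSL ℝ (e i)).intervalIntegral_comp_comm (hsub t ht)).symm
  have key : ∀ i, ∫ t in a..b, ⟪p t, e i⟫_ℝ * ∫ u in a..t, ⟪e i, w u⟫_ℝ =
      ⟪q b, e i⟫_ℝ * (∫ u in a..b, ⟪e i, w u⟫_ℝ) - ∫ t in a..b, ⟪q t, e i⟫_ℝ * ⟪e i, w t⟫_ℝ := by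
    intro i
    have hqi : ∀ t, HasDerivAt (fun t => ⟪q t, e i⟫_ℝ) (⟪p t, e i⟫_ℝ) t := fun t => by
      simpa using (hq t).inner ℝ (hasDerivAt_const t (e i))
    have hd : deriv (fun t => ⟪q t, e i⟫_ℝ) = fun t => ⟪p t, e i⟫_ℝ :=
      funext fun t => (hqi t).deriv
    have h1 : AbsolutelyContinuousOnInterval (fun t => ⟪q t, e i⟫_ℝ) a b := by
      have : ContDiff ℝ 1 (fun t => ⟪q t, e i⟫_ℝ) := by
        rw [contDiff_one_iff_deriv]
        exact ⟨fun t => (hqi t).differentiableAt, by rw [hd]; fun_prop⟩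
      exact this.contDiffOn.absolutelyContinuousOnInterval
    have h2 := (hwi i).absolutelyContinuousOnInterval_intervalIntegral (c := a) (by simp)
    have h4 := h1.integral_mul_deriv_eq_deriv_mul h2
    have h5 : ∫ t in a..b, ⟪q t, e i⟫_ℝ * deriv (fun x => ∫ u in a..x, ⟪e i, w u⟫_ℝ) t =
        ∫ t in a..b, ⟪q t, e i⟫_ℝ * ⟪e i, w t⟫_ℝ := by
      apply intervalIntegral.integral_congr_ae
      filter_upwards [(hwi i).ae_hasDerivAt_integral] with t ht htm
      rw [(ht (uIoc_subset_uIcc htm) a (by simp)).deriv]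
    rw [h5, hd] at h4
    simp at h4
    linarith
  have hL : ∫ t in a..b, ⟪p t, ∫ u in a..t, w u⟫_ℝ =
      ∑ i, ∫ t in a..b, ⟪p t, e i⟫_ℝ * ∫ u in a..t, ⟪e i, w u⟫_ℝ := by
    rw [← intervalIntegral.integral_finsetSum]
    · apply intervalIntegral.integral_congr
      intro t ht
      simp only
      rw [← e.sum_inner_mul_inner]
      exact Finset.sum_congr rfl fun i _ => by rw [hprim i t ht]
    · intro i _
      apply ContinuousOn.intervalIntegrable
      refine ContinuousOn.mul (by fun_prop) ?_
      exact intervalIntegral.continuousOn_primitive_interval' (hwi i) (by simp)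
  have hR : ∫ t in a..b, ⟪q t, w t⟫_ℝ = ∑ i, ∫ t in a..b, ⟪q t, e i⟫_ℝ * ⟪e i, w t⟫_ℝ := by
    rw [← intervalIntegral.integral_finsetSum]
    · apply intervalIntegral.integral_congr
      intro t ht
      simp only
      rw [← e.sum_inner_mul_inner]
    · intro i _
      exact (hwi i).continuousOn_mul (by fun_prop)
  rw [hL, hR, Finset.sum_congr rfl fun i _ => key i, Finset.sum_sub_distrib]
  congr 1
  rw [← e.sum_inner_mul_inner]
  exact Finset.sum_congr rfl fun i _ => by rw [hprim i b (by simp)]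

/-- Bounded sequences in a separable Hilbert space have weakly convergent subsequences. -/
lemma exists_subseq_tendsto_inner {H : Type*} [NormedAddCommGroup H] [InnerProductSpace ℝ H]
    [CompleteSpace H] [TopologicalSpace.SeparableSpace H] {f : ℕ → H} {R : ℝ}
    (hf : ∀ k, ‖f k‖ ≤ R) :
    ∃ (f₀ : H) (φ : ℕ → ℕ), StrictMono φ ∧
      ∀ h : H, Tendsto (fun k => ⟪f (φ k), h⟫_ℝ) atTop (𝓝 ⟪f₀, h⟫_ℝ) := by
  have hc := WeakDual.isSeqCompact_closedBall ℝ H (0 : StrongDual ℝ H) R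
  obtain ⟨ℓ, -, φ, hφ, hlim⟩ := hc
    (x := fun k => StrongDual.toWeakDual (InnerProductSpace.toDual ℝ H (f k)))
    (fun k => by simpa using hf k)
  refine ⟨(InnerProductSpace.toDual ℝ H).symm (WeakDual.toStrongDual ℓ), φ, hφ, fun h => ?_⟩
  have h2 := ((WeakDual.eval_continuous h).tendsto ℓ).comp hlim
  simpa [Function.comp_def] using h2

/-- The velocity `g` has finite energy and its curve ending at `x` has finite potential cost. -/
def Admissible (V : E → ℝ) (x : E) (g : ℝ → E) : Prop :=
  MemLp g 2 (volume.restrict (Iic 0)) ∧ IntegrableOn (fun t => V (backwardCurve x g t)) (Iic 0)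

/-- The action of the curve with velocity `g` ending at `x`. -/
noncomputable def action (V : E → ℝ) (x : E) (g : ℝ → E) : ℝ :=
  (1/2 : ℝ) * (∫ t in Iic (0:ℝ), ‖g t‖ ^ 2) + ∫ t in Iic (0:ℝ), V (backwardCurve x g t)

lemma Admissible.congr_ae {V : E → ℝ} {x : E} {g h : ℝ → E} (hg : Admissible V x g)
    (hgh : g =ᵐ[volume.restrict (Iic 0)] h) :
    Admissible V x h ∧ action V x h = action V x g := by
  have hc : ∀ t ≤ 0, backwardCurve x h t = backwardCurve x g t := fun t ht => by
    unfold backwardCurve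
    congr 1
    apply intervalIntegral.integral_congr_ae
    have := (ae_restrict_iff' measurableSet_Iic).1 hgh
    filter_upwards [this] with u hu hut
    rw [uIoc_of_le ht] at hut
    exact (hu hut.2).symm
  have hV : EqOn (fun t => V (backwardCurve x g t)) (fun t => V (backwardCurve x h t)) (Iic 0) :=
    fun t ht => by simp only [hc t ht]
  refine ⟨⟨(memLp_congr_ae hgh).1 hg.1, hg.2.congr_fun hV measurableSet_Iic⟩, ?_⟩
  unfold action
  rw [setIntegral_congr_fun measurableSet_Iic hV]
  congr 2
  exact integral_congr_ae (by filter_upwards [hgh] with t ht; rw [ht])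

lemma tendsto_backwardCurve_of_tendsto_inner [FiniteDimensional ℝ E] (x : E)
    {f : ℕ → Lp E 2 (volume.restrict (Iic (0:ℝ)))} {f₀ : Lp E 2 (volume.restrict (Iic (0:ℝ)))}
    (hf : ∀ h, Tendsto (fun k => ⟪f k, h⟫_ℝ) atTop (𝓝 ⟪f₀, h⟫_ℝ)) {t : ℝ} (ht : t ≤ 0) :
    Tendsto (fun k => backwardCurve x (f k) t) atTop (𝓝 (backwardCurve x f₀ t)) := by
  have hfin : (volume.restrict (Iic (0:ℝ))) (Ioc t 0) ≠ ⊤ :=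
    ((Measure.restrict_apply_le _ _).trans_lt measure_Ioc_lt_top).ne
  have hrep : ∀ (g : Lp E 2 (volume.restrict (Iic (0:ℝ)))) (c : E),
      ⟪g, indicatorConstLp 2 measurableSet_Ioc hfin c⟫_ℝ = ⟪c, ∫ u in t..(0:ℝ), g u⟫_ℝ := by
    intro g c
    rw [real_inner_comm, L2.inner_indicatorConstLp_eq_inner_setIntegral ℝ measurableSet_Ioc hfin c g,
      intervalIntegral.integral_of_le ht, Measure.restrict_restrict measurableSet_Ioc,
      inter_eq_left.2 Ioc_subset_Iic_self]
  have hI : Tendsto (fun k => ∫ u in t..(0:ℝ), f k u) atTop (𝓝 (∫ u in t..(0:ℝ), f₀ u)) := by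
    let e := stdOrthonormalBasis ℝ E
    have h : Tendsto (fun k => ∑ i, ⟪e i, ∫ u in t..(0:ℝ), f k u⟫_ℝ • e i) atTop
        (𝓝 (∑ i, ⟪e i, ∫ u in t..(0:ℝ), f₀ u⟫_ℝ • e i)) := by
      refine tendsto_finsetSum _ fun i _ => Tendsto.smul_const ?_ _
      simp_rw [← hrep]
      exact hf _
    simpa only [e.sum_repr'] using h
  exact tendsto_const_nhds.sub hI

lemma norm_sq_toLp {g : ℝ → E} (hg : MemLp g 2 (volume.restrict (Iic 0))) :
    ‖hg.toLp g‖ ^ 2 = ∫ t in Iic (0:ℝ), ‖g t‖ ^ 2 := by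
  rw [← real_inner_self_eq_norm_sq, L2.inner_def]
  refine integral_congr_ae ?_
  filter_upwards [hg.coeFn_toLp] with t ht
  rw [ht, real_inner_self_eq_norm_sq]

/-- The direct method: the action attains its minimum over admissible velocities. -/
lemma exists_admissible_forall_action_le [FiniteDimensional ℝ E] {V : E → ℝ} (hV : Continuous V)
    (hVpos : ∀ y, 0 ≤ V y) (x : E) (hne : ∃ g, Admissible V x g) :
    ∃ g, Admissible V x g ∧ ∀ h, Admissible V x h → action V x g ≤ action V x h := by
  let S : Set ℝ := action V x '' {g | Admissible V x g}
  have hS : S.Nonempty := let ⟨g, hg⟩ := hne; ⟨_, g, hg, rfl⟩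
  have hVint : ∀ g, 0 ≤ ∫ t in Iic (0:ℝ), V (backwardCurve x g t) := fun g =>
    integral_nonneg fun t => hVpos _
  have hbdd : BddBelow S := by
    refine ⟨0, ?_⟩
    rintro _ ⟨g, -, rfl⟩
    have : 0 ≤ ∫ t in Iic (0:ℝ), ‖g t‖ ^ 2 := integral_nonneg fun t => by positivity
    have := hVint g
    unfold action
    positivity
  obtain ⟨r, hr_anti, hr_lim, hr_mem⟩ := exists_seq_tendsto_sInf hS hbdd
  choose G hG hGr using hr_mem
  let f : ℕ → Lp E 2 (volume.restrict (Iic (0:ℝ))) := fun k => (hG k).1.toLp (G k)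
  have hfG : ∀ k, Admissible V x (f k) ∧ action V x (f k) = r k := fun k => by
    have := (hG k).congr_ae (hG k).1.coeFn_toLp.symm
    exact ⟨this.1, this.2.trans (hGr k)⟩
  have hfact : ∀ k, r k = (1/2 : ℝ) * ‖f k‖ ^ 2 + ∫ t in Iic (0:ℝ), V (backwardCurve x (f k) t) := by
    intro k
    rw [← (hfG k).2, action]
    congr 2
    rw [← norm_sq_toLp (Lp.memLp (f k)), Lp.toLp_coeFn]
  have hfb : ∀ k, ‖f k‖ ≤ Real.sqrt (2 * r 0) := by
    intro k
    apply Real.le_sqrt_of_sq_le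
    have := hr_anti (Nat.zero_le k)
    have := hVint (f k)
    have := hfact k
    linarith
  have : Fact ((2 : ENNReal) ≠ ⊤) := ⟨by simp⟩
  have := FiniteDimensional.proper ℝ E
  obtain ⟨f₀, φ, hφ, hw⟩ := exists_subseq_tendsto_inner hfb
  have hcurve : ∀ g : Lp E 2 (volume.restrict (Iic (0:ℝ))),
      ContinuousOn (backwardCurve x g) (Iic 0) := fun g =>
    continuousOn_backwardCurve x fun a ha => (Lp.memLp g).intervalIntegrable_of_Iic ha le_rfl
  have hmeas : ∀ g : Lp E 2 (volume.restrict (Iic (0:ℝ))),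
      AEStronglyMeasurable (fun t => V (backwardCurve x g t)) (volume.restrict (Iic 0)) := fun g =>
    (hV.comp_continuousOn (hcurve g)).aestronglyMeasurable measurableSet_Iic
  let c : ℕ → ℝ := fun k => r (φ k) - ⟪f (φ k), f₀⟫_ℝ + (1/2 : ℝ) * ‖f₀‖ ^ 2
  have hc : ∀ k, ∫ t in Iic (0:ℝ), V (backwardCurve x (f (φ k)) t) ≤ c k := by
    intro k
    have h1 := hfact (φ k)
    have h2 : 0 ≤ ‖f (φ k) - f₀‖ ^ 2 := by positivity
    rw [norm_sub_sq_real] at h2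
    simp only [c]
    linarith
  have hclim : Tendsto c atTop (𝓝 (sInf S - (1/2 : ℝ) * ‖f₀‖ ^ 2)) := by
    have := ((hr_lim.comp hφ.tendsto_atTop).sub (hw f₀)).add_const ((1/2 : ℝ) * ‖f₀‖ ^ 2)
    rw [real_inner_self_eq_norm_sq] at this
    rw [show sInf S - (1/2 : ℝ) * ‖f₀‖ ^ 2 = sInf S - ‖f₀‖ ^ 2 + (1/2 : ℝ) * ‖f₀‖ ^ 2 by ring]
    exact this
  have hclim0 : 0 ≤ sInf S - (1/2 : ℝ) * ‖f₀‖ ^ 2 :=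
    ge_of_tendsto' hclim fun k => (hVint _).trans (hc k)
  have hfatou : ∫⁻ t in Iic (0:ℝ), ENNReal.ofReal (V (backwardCurve x f₀ t)) ≤
      ENNReal.ofReal (sInf S - (1/2 : ℝ) * ‖f₀‖ ^ 2) := by
    calc ∫⁻ t in Iic (0:ℝ), ENNReal.ofReal (V (backwardCurve x f₀ t))
        ≤ ∫⁻ t in Iic (0:ℝ), liminf
            (fun k => ENNReal.ofReal (V (backwardCurve x (f (φ k)) t))) atTop := by
          refine setLIntegral_mono_ae' measurableSet_Iic (ae_of_all _ fun t ht => ?_)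
          have h1 := tendsto_backwardCurve_of_tendsto_inner x hw (mem_Iic.1 ht)
          have h2 := ENNReal.tendsto_ofReal ((hV.tendsto _).comp h1)
          exact h2.liminf_eq.ge
      _ ≤ liminf (fun k => ∫⁻ t in Iic (0:ℝ),
            ENNReal.ofReal (V (backwardCurve x (f (φ k)) t))) atTop :=
          lintegral_liminf_le' fun k => (hmeas _).aemeasurable.ennreal_ofReal
      _ ≤ liminf (fun k => ENNReal.ofReal (c k)) atTop := by
          refine liminf_le_liminf (Eventually.of_forall fun k => ?_)
          rw [← ofReal_integral_eq_lintegral_ofReal (hfG (φ k)).1.2 (ae_of_all _ fun t => hVpos _)]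
          exact ENNReal.ofReal_le_ofReal (hc k)
      _ = _ := (ENNReal.tendsto_ofReal hclim).liminf_eq
  have hVγ : IntegrableOn (fun t => V (backwardCurve x f₀ t)) (Iic 0) := by
    refine ⟨hmeas f₀, ?_⟩
    rw [hasFiniteIntegral_iff_ofReal (ae_of_all _ fun t => hVpos _)]
    exact hfatou.trans_lt ENNReal.ofReal_lt_top
  refine ⟨f₀, ⟨Lp.memLp f₀, hVγ⟩, fun h hh => ?_⟩
  refine le_trans ?_ (csInf_le hbdd ⟨h, hh, rfl⟩)
  rw [← ofReal_integral_eq_lintegral_ofReal hVγ (ae_of_all _ fun t => hVpos _),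
    ENNReal.ofReal_le_ofReal_iff hclim0] at hfatou
  rw [action, ← norm_sq_toLp (Lp.memLp f₀), Lp.toLp_coeFn]
  linarith

lemma backwardCurve_add_smul (x : E) {g w : ℝ → E} (s : ℝ) {t : ℝ}
    (hg : IntervalIntegrable g volume t 0) (hw : IntervalIntegrable w volume t 0) :
    backwardCurve x (g + s • w) t = backwardCurve x g t + s • backwardCurve 0 w t := by
  simp only [backwardCurve, Pi.add_apply, Pi.smul_apply]
  have hsw : IntervalIntegrable (fun u => s • w u) volume t 0 := hw.smul s
  rw [intervalIntegral.integral_add hg hsw, intervalIntegral.integral_smul]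
  module

lemma integrable_inner_of_memLp_two {α : Type*} [MeasurableSpace α] {μ : Measure α} {g w : α → E}
    (hg : MemLp g 2 μ) (hw : MemLp w 2 μ) : Integrable (fun t => ⟪g t, w t⟫_ℝ) μ := by
  refine (hg.norm.integrable_mul hw.norm).mono (hg.1.inner hw.1) (ae_of_all _ fun t => ?_)
  simpa using norm_inner_le_norm (𝕜 := ℝ) (g t) (w t)

lemma integral_norm_add_smul_sq {α : Type*} [MeasurableSpace α] {μ : Measure α} {g w : α → E}
    (hg : MemLp g 2 μ) (hw : MemLp w 2 μ) (s : ℝ) :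
    ∫ t, ‖(g + s • w) t‖ ^ 2 ∂μ =
      ∫ t, ‖g t‖ ^ 2 ∂μ + 2 * s * ∫ t, ⟪g t, w t⟫_ℝ ∂μ + s ^ 2 * ∫ t, ‖w t‖ ^ 2 ∂μ := by
  have h1 := (memLp_two_iff_integrable_sq_norm hg.1).1 hg
  have h2 := (memLp_two_iff_integrable_sq_norm hw.1).1 hw
  have h3 := integrable_inner_of_memLp_two hg hw
  have h4 : Integrable (fun t => ‖g t‖ ^ 2 + 2 * s * ⟪g t, w t⟫_ℝ) μ := h1.add (h3.const_mul _)
  rw [← integral_const_mul, ← integral_const_mul, ← integral_add h1 (h3.const_mul _),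
    ← integral_add h4 (h2.const_mul _)]
  congr 1 with t
  simp only [Pi.add_apply, Pi.smul_apply]
  rw [norm_add_sq_real, inner_smul_right, norm_smul, mul_pow, Real.norm_eq_abs, sq_abs]
  ring

lemma continuous_gradient_of_contDiff [CompleteSpace E] {V : E → ℝ} (hV : ContDiff ℝ 1 V) :
    Continuous (gradient V) :=
  (InnerProductSpace.toDual ℝ E).symm.continuous.comp (hV.continuous_fderiv one_ne_zero)

/-- Differentiation under the integral sign of the potential energy along a variation. -/
lemma hasDerivAt_integral_potential [CompleteSpace E] {V : E → ℝ} (hV : ContDiff ℝ 1 V)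
    {γ η : ℝ → E} {T : ℝ} (hγ : ContinuousOn γ (Icc T 0)) (hη : ContinuousOn η (Icc T 0)) :
    HasDerivAt (fun s : ℝ => ∫ t in Ioc T 0, V (γ t + s • η t))
      (∫ t in Ioc T 0, ⟪gradient V (γ t), η t⟫_ℝ) 0 := by
  have hgrad := continuous_gradient_of_contDiff hV
  have hcomp : ContinuousOn (fun z : ℝ × ℝ => ⟪gradient V (γ z.2 + z.1 • η z.2), η z.2⟫_ℝ)
      (Icc (-1) 1 ×ˢ Icc T 0) := by
    have hγ' : ContinuousOn (fun z : ℝ × ℝ => γ z.2) (Icc (-1) 1 ×ˢ Icc T 0) :=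
      hγ.comp continuousOn_snd fun z hz => hz.2
    have hη' : ContinuousOn (fun z : ℝ × ℝ => η z.2) (Icc (-1) 1 ×ˢ Icc T 0) :=
      hη.comp continuousOn_snd fun z hz => hz.2
    exact (hgrad.comp_continuousOn (hγ'.add (continuousOn_fst.smul hη'))).inner hη'
  obtain ⟨C, hC⟩ := (isCompact_Icc.prod isCompact_Icc).exists_bound_of_continuousOn hcomp
  have hcont : ∀ s : ℝ, ContinuousOn (fun t => V (γ t + s • η t)) (Icc T 0) := fun s =>
    hV.continuous.comp_continuousOn (hγ.add (hη.const_smul s))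
  have hcont' : ContinuousOn (fun t => ⟪gradient V (γ t + (0:ℝ) • η t), η t⟫_ℝ) (Icc T 0) :=
    (hgrad.comp_continuousOn (hγ.add (hη.const_smul 0))).inner hη
  have h := (hasDerivAt_integral_of_dominated_loc_of_deriv_le (𝕜 := ℝ)
    (μ := volume.restrict (Ioc T 0)) (x₀ := (0:ℝ)) (s := Icc (-1) 1) (bound := fun _ => C)
    (F := fun s t => V (γ t + s • η t))
    (F' := fun s t => ⟪gradient V (γ t + s • η t), η t⟫_ℝ)
    (Icc_mem_nhds (by norm_num) (by norm_num))
    (Eventually.of_forall fun s =>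
      ((hcont s).mono Ioc_subset_Icc_self).aestronglyMeasurable measurableSet_Ioc)
    (((hcont 0).integrableOn_Icc).mono_set Ioc_subset_Icc_self)
    ((hcont'.mono Ioc_subset_Icc_self).aestronglyMeasurable measurableSet_Ioc)
    ((ae_restrict_iff' measurableSet_Ioc).2 (ae_of_all _ fun t ht s hs =>
      hC (s, t) ⟨hs, Ioc_subset_Icc_self ht⟩))
    (integrable_const C)
    (ae_of_all _ fun t s _ => ?_)).2
  · simpa using h
  · have h1 : HasDerivAt (fun s : ℝ => γ t + s • η t) (η t) s := by
      simpa using ((hasDerivAt_id s).smul_const (η t)).const_add (γ t)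
    have h2 := (hV.differentiable one_ne_zero (γ t + s • η t)).hasGradientAt.hasFDerivAt
    simpa [Function.comp_def] using h2.comp_hasDerivAt s h1

/-- The first variation of the action vanishes at a minimizer. -/
lemma first_variation_eq_zero [CompleteSpace E] {V : E → ℝ} (hV : ContDiff ℝ 1 V) {x : E}
    {g w : ℝ → E} (hg : Admissible V x g)
    (hmin : ∀ h, Admissible V x h → action V x g ≤ action V x h)
    (hw : MemLp w 2 (volume.restrict (Iic 0))) {T : ℝ} (hT : T ≤ 0)
    (hwT : ∀ t ≤ T, backwardCurve 0 w t = 0) :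
    (∫ t in Iic (0:ℝ), ⟪g t, w t⟫_ℝ) +
      ∫ t in Ioc T 0, ⟪gradient V (backwardCurve x g t), backwardCurve 0 w t⟫_ℝ = 0 := by
  have hgi : ∀ t ≤ 0, IntervalIntegrable g volume t 0 := fun t ht =>
    hg.1.intervalIntegrable_of_Iic ht le_rfl
  have hwi : ∀ t ≤ 0, IntervalIntegrable w volume t 0 := fun t ht =>
    hw.intervalIntegrable_of_Iic ht le_rfl
  have hγ := (continuousOn_backwardCurve x hgi).mono (Icc_subset_Iic_self : Icc T 0 ⊆ Iic 0)
  have hη := (continuousOn_backwardCurve 0 hwi).mono (Icc_subset_Iic_self : Icc T 0 ⊆ Iic 0)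
  have hcurve : ∀ s : ℝ, ∀ t ≤ 0, backwardCurve x (g + s • w) t =
      backwardCurve x g t + s • backwardCurve 0 w t := fun s t ht =>
    backwardCurve_add_smul x s (hgi t ht) (hwi t ht)
  have hleft : ∀ s : ℝ, EqOn (fun t => V (backwardCurve x g t))
      (fun t => V (backwardCurve x (g + s • w) t)) (Iic T) := fun s t ht => by
    simp only [hcurve s t (le_trans ht hT), hwT t ht, smul_zero, add_zero]
  have hright : ∀ s : ℝ, EqOn (fun t => V (backwardCurve x g t + s • backwardCurve 0 w t))
      (fun t => V (backwardCurve x (g + s • w) t)) (Ioc T 0) := fun s t ht => by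
    simp only [hcurve s t ht.2]
  have hleft_int : ∀ s : ℝ, IntegrableOn (fun t => V (backwardCurve x (g + s • w) t)) (Iic T) :=
    fun s => (hg.2.mono_set (Iic_subset_Iic.2 hT)).congr_fun (hleft s) measurableSet_Iic
  have hright_int : ∀ s : ℝ, IntegrableOn (fun t => V (backwardCurve x (g + s • w) t)) (Ioc T 0) :=
    fun s => IntegrableOn.congr_fun (((hV.continuous.comp_continuousOn
      (hγ.add (hη.const_smul s))).integrableOn_Icc).mono_set Ioc_subset_Icc_self)
      (hright s) measurableSet_Ioc
  have hadm : ∀ s : ℝ, Admissible V x (g + s • w) := fun s =>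
    ⟨hg.1.add (hw.const_smul s), by
      rw [← Iic_union_Ioc_eq_Iic hT]; exact (hleft_int s).union (hright_int s)⟩
  have hact : ∀ s : ℝ, action V x (g + s • w) =
      (1/2 : ℝ) * ((∫ t in Iic (0:ℝ), ‖g t‖ ^ 2) + 2 * s * (∫ t in Iic (0:ℝ), ⟪g t, w t⟫_ℝ) +
        s ^ 2 * ∫ t in Iic (0:ℝ), ‖w t‖ ^ 2) + ((∫ t in Iic T, V (backwardCurve x g t)) +
        ∫ t in Ioc T 0, V (backwardCurve x g t + s • backwardCurve 0 w t)) := by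
    intro s
    rw [action, integral_norm_add_smul_sq hg.1 hw s, ← Iic_union_Ioc_eq_Iic hT,
      setIntegral_union (Iic_disjoint_Ioc le_rfl) measurableSet_Ioc (hleft_int s) (hright_int s),
      setIntegral_congr_fun measurableSet_Iic (hleft s),
      setIntegral_congr_fun measurableSet_Ioc (hright s)]
  have hderiv : HasDerivAt (fun s : ℝ => action V x (g + s • w))
      ((∫ t in Iic (0:ℝ), ⟪g t, w t⟫_ℝ) +
        ∫ t in Ioc T 0, ⟪gradient V (backwardCurve x g t), backwardCurve 0 w t⟫_ℝ) 0 := by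
    simp_rw [hact]
    have h1 := hasDerivAt_integral_potential hV hγ hη
    have h2 := ((((hasDerivAt_id (0:ℝ)).const_mul 2).mul_const
      (∫ t in Iic (0:ℝ), ⟪g t, w t⟫_ℝ)).const_add (∫ t in Iic (0:ℝ), ‖g t‖ ^ 2)).add
      (((hasDerivAt_id (0:ℝ)).pow 2).mul_const (∫ t in Iic (0:ℝ), ‖w t‖ ^ 2))
    exact ((h2.const_mul (1/2 : ℝ)).add
      (h1.const_add (∫ t in Iic T, V (backwardCurve x g t)))).congr_deriv (by simp)
  refine IsLocalMin.hasDerivAt_eq_zero (Eventually.of_forall fun s => ?_) hderiv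
  simpa using hmin _ (hadm s)

/-- The du Bois-Reymond argument on a compact interval. -/
lemma exists_ae_eq_const_add [FiniteDimensional ℝ E] {V : E → ℝ} (hV : ContDiff ℝ 1 V) {x : E}
    {g p q : ℝ → E} (hg : Admissible V x g)
    (hmin : ∀ h, Admissible V x h → action V x g ≤ action V x h)
    (hp : Continuous p) (hq : ∀ t, HasDerivAt q (p t) t)
    (hpV : ∀ t ≤ 0, p t = gradient V (backwardCurve x g t)) {T : ℝ} (hT : T < 0) :
    ∃ c : E, ∀ᵐ t ∂volume.restrict (Ioc T 0), g t = c + q t := by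
  have := FiniteDimensional.complete ℝ E
  have hqc : Continuous q := continuous_iff_continuousAt.2 fun t => (hq t).continuousAt
  have hsub : Ioc T 0 ⊆ Iic 0 := Ioc_subset_Iic_self
  have hgT : MemLp g 2 (volume.restrict (Ioc T 0)) :=
    hg.1.mono_measure (Measure.restrict_mono hsub le_rfl)
  have hqT : MemLp q 2 (volume.restrict (Ioc T 0)) := by
    obtain ⟨C, hC⟩ := isCompact_Icc.exists_bound_of_continuousOn (hqc.continuousOn (s := Icc T 0))
    exact MemLp.of_bound hqc.aestronglyMeasurable C
      ((ae_restrict_iff' measurableSet_Ioc).2 (ae_of_all _ fun t ht => hC t ⟨ht.1.le, ht.2⟩))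
  let d : ℝ → E := g - q
  have hd : MemLp d 2 (volume.restrict (Ioc T 0)) := hgT.sub hqT
  have hdi : IntegrableOn d (Ioc T 0) := hd.integrable one_le_two
  let c : E := (-T)⁻¹ • ∫ t in Ioc T 0, d t
  let v : ℝ → E := fun t => d t - c
  have hv : MemLp v 2 (volume.restrict (Ioc T 0)) := hd.sub (memLp_const c)
  have hvi : IntegrableOn v (Ioc T 0) := hv.integrable one_le_two
  have hv0 : ∫ t in Ioc T 0, v t = 0 := by
    have hTne : (-T) ≠ 0 := by linarith
    simp only [v]
    rw [integral_sub hdi (integrable_const c)]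
    simp only [integral_const, Measure.real, Measure.restrict_apply_univ, Real.volume_Ioc, zero_sub,
      ENNReal.toReal_ofReal (neg_nonneg.2 hT.le), c]
    rw [smul_smul, mul_inv_cancel₀ hTne, one_smul, sub_self]
  let w : ℝ → E := (Ioc T 0).indicator v
  have hw : MemLp w 2 (volume.restrict (Iic 0)) := by
    rw [memLp_indicator_iff_restrict measurableSet_Ioc,
      Measure.restrict_restrict measurableSet_Ioc, inter_eq_left.2 hsub]
    exact hv
  have hwi : ∀ a ≤ 0, ∀ b ≤ 0, IntervalIntegrable w volume a b := fun a ha b hb =>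
    hw.intervalIntegrable_of_Iic ha hb
  have hwv : ∫ t in T..(0:ℝ), w t = 0 := by
    rw [intervalIntegral.integral_of_le hT.le, setIntegral_indicator measurableSet_Ioc, inter_self,
      hv0]
  have hη : ∀ t ≤ 0, backwardCurve 0 w t = ∫ u in T..t, w u := fun t ht => by
    rw [backwardCurve, zero_sub, ← intervalIntegral.integral_interval_sub_left
      (hwi T hT.le 0 le_rfl) (hwi T hT.le t ht), hwv, zero_sub, neg_neg]
  have hηT : ∀ t ≤ T, backwardCurve 0 w t = 0 := fun t ht => by
    rw [hη t (ht.trans hT.le), intervalIntegral.integral_symm, intervalIntegral.integral_of_le ht,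
      setIntegral_indicator measurableSet_Ioc,
      (disjoint_iff_inter_eq_empty.1 (Ioc_disjoint_Ioc_of_le le_rfl))]
    simp
  have hfv := first_variation_eq_zero hV hg hmin hw hT.le hηT
  have hibp := intervalIntegral_inner_primitive hp hq (hwi T hT.le 0 le_rfl)
  rw [hwv, inner_zero_right, zero_sub, intervalIntegral.integral_of_le hT.le,
    intervalIntegral.integral_of_le hT.le] at hibp
  have h1 : ∫ t in Ioc T 0, ⟪gradient V (backwardCurve x g t), backwardCurve 0 w t⟫_ℝ =
      -∫ t in Ioc T 0, ⟪q t, v t⟫_ℝ := by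
    rw [setIntegral_congr_fun measurableSet_Ioc (g := fun t => ⟪p t, ∫ u in T..t, w u⟫_ℝ), hibp]
    · congr 1
      exact setIntegral_congr_fun measurableSet_Ioc fun t ht => by simp only [w, indicator_of_mem ht]
    · intro t ht
      simp only [hη t ht.2, hpV t ht.2]
  have h2 : ∫ t in Iic (0:ℝ), ⟪g t, w t⟫_ℝ = ∫ t in Ioc T 0, ⟪g t, v t⟫_ℝ := by
    have : (fun t => ⟪g t, w t⟫_ℝ) = (Ioc T 0).indicator (fun t => ⟪g t, v t⟫_ℝ) := by
      funext t
      by_cases ht : t ∈ Ioc T 0 <;> simp [w, ht]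
    rw [this, setIntegral_indicator measurableSet_Ioc, inter_eq_right.2 hsub]
  have h3 : ∫ t in Ioc T 0, ⟪c, v t⟫_ℝ = 0 := by
    rw [integral_inner hvi, hv0, inner_zero_right]
  have h4 : ∫ t in Ioc T 0, ‖v t‖ ^ 2 = 0 := by
    have hgv := integrable_inner_of_memLp_two hgT hv
    have hqv := integrable_inner_of_memLp_two hqT hv
    have hcv := integrable_inner_of_memLp_two (memLp_const c) hv
    have hgqv : IntegrableOn (fun t => ⟪g t, v t⟫_ℝ - ⟪q t, v t⟫_ℝ) (Ioc T 0) := hgv.sub hqv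
    calc ∫ t in Ioc T 0, ‖v t‖ ^ 2
        = ∫ t in Ioc T 0, (⟪g t, v t⟫_ℝ - ⟪q t, v t⟫_ℝ - ⟪c, v t⟫_ℝ) := by
          congr 1 with t
          rw [← inner_sub_left, ← inner_sub_left, ← real_inner_self_eq_norm_sq]
          rfl
      _ = 0 := by
          rw [integral_sub hgqv hcv, integral_sub hgv hqv, h3]
          linarith
  rw [integral_eq_zero_iff_of_nonneg (fun t => by positivity)
    ((memLp_two_iff_integrable_sq_norm hv.1).1 hv)] at h4
  refine ⟨c, ?_⟩
  filter_upwards [h4] with t ht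
  have : v t = 0 := by simpa using ht
  rw [← sub_eq_zero, ← this]
  simp only [v, d, Pi.sub_apply]
  abel

lemma iUnion_Ioc_neg_nat_eq_Iic : ⋃ k : ℕ, Ioc (-((k : ℝ) + 1)) 0 = Iic 0 := by
  ext t
  simp only [mem_iUnion, mem_Ioc, mem_Iic]
  refine ⟨fun ⟨_, h⟩ => h.2, fun h => ?_⟩
  obtain ⟨k, hk⟩ := exists_nat_gt (-t)
  exact ⟨k, by linarith, h⟩

/-- The velocity of a minimizer coincides almost everywhere with a primitive of the force. -/
lemma exists_ae_eq_const_add_Iic [FiniteDimensional ℝ E] {V : E → ℝ} (hV : ContDiff ℝ 1 V) {x : E}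
    {g p q : ℝ → E} (hg : Admissible V x g)
    (hmin : ∀ h, Admissible V x h → action V x g ≤ action V x h)
    (hp : Continuous p) (hq : ∀ t, HasDerivAt q (p t) t)
    (hpV : ∀ t ≤ 0, p t = gradient V (backwardCurve x g t)) :
    ∃ c : E, ∀ᵐ t ∂volume.restrict (Iic 0), g t = c + q t := by
  have hneg : ∀ k : ℕ, -((k : ℝ) + 1) < 0 := fun k => by
    have : (0:ℝ) ≤ k := k.cast_nonneg
    linarith
  choose c hc using fun k : ℕ => exists_ae_eq_const_add hV hg hmin hp hq hpV (hneg k)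
  refine ⟨c 0, ?_⟩
  rw [← iUnion_Ioc_neg_nat_eq_Iic, ae_restrict_iUnion_iff]
  intro k
  have hsub : Ioc (-(((0 : ℕ) : ℝ) + 1)) 0 ⊆ Ioc (-((k : ℝ) + 1)) 0 :=
    Ioc_subset_Ioc_left (by have : (0:ℝ) ≤ k := k.cast_nonneg
                            push_cast; linarith)
  have hck : ∀ᵐ t ∂volume.restrict (Ioc (-(((0 : ℕ) : ℝ) + 1)) 0), g t = c k + q t :=
    ae_mono (Measure.restrict_mono hsub le_rfl) (hc k)
  have hne : NeBot (ae (volume.restrict (Ioc (-(((0 : ℕ) : ℝ) + 1)) 0))) := by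
    rw [ae_neBot, Ne, Measure.restrict_eq_zero, Real.volume_Ioc]
    simp
  obtain ⟨t, ht, ht'⟩ := (hck.and (hc 0)).exists
  rw [add_right_cancel (ht'.symm.trans ht)]
  exact hc k

/-- The existence of an admissible curve does not depend on its endpoint. -/
lemma Admissible.exists_of_endpoint [CompleteSpace E] {V : E → ℝ} (hV : Continuous V) {y : E}
    {g : ℝ → E} (hg : Admissible V y g) (x : E) : ∃ h, Admissible V x h := by
  have hpre : (fun t : ℝ => t + 1) ⁻¹' Iic 0 = Iic (-1) := by
    ext t
    simp only [mem_preimage, mem_Iic]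
    constructor <;> intro h <;> linarith
  have hmp : MeasurePreserving (fun t : ℝ => t + 1) (volume.restrict (Iic (-1)))
      (volume.restrict (Iic 0)) := by
    have h := (measurePreserving_add_right (volume : Measure ℝ) 1).restrict_preimage
      (measurableSet_Iic (a := (0:ℝ)))
    rwa [hpre] at h
  let h : ℝ → E := (Iic (-1)).indicator (fun t => g (t + 1)) +
    (Ioc (-1) 0).indicator (fun _ => x - y)
  have hle : ∀ t ≤ -1, h t = g (t + 1) := fun t ht => by
    have h1 : t ∈ Iic (-1 : ℝ) := ht
    have h2 : t ∉ Ioc (-1 : ℝ) 0 := fun h' => absurd h'.1 (not_lt.2 ht)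
    simp only [h, Pi.add_apply, indicator_of_mem h1, indicator_of_notMem h2, add_zero]
  have hgt : ∀ t ∈ Ioc (-1 : ℝ) 0, h t = x - y := fun t ht => by
    have h1 : t ∉ Iic (-1 : ℝ) := fun h' => absurd ht.1 (not_lt.2 h')
    simp only [h, Pi.add_apply, indicator_of_mem ht, indicator_of_notMem h1, zero_add]
  have hh : MemLp h 2 (volume.restrict (Iic 0)) := by
    refine MemLp.add ?_ ?_
    · rw [memLp_indicator_iff_restrict measurableSet_Iic,
        Measure.restrict_restrict measurableSet_Iic, Iic_inter_Iic, min_eq_left (by norm_num)]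
      exact hg.1.comp_measurePreserving hmp
    · rw [memLp_indicator_iff_restrict measurableSet_Ioc,
        Measure.restrict_restrict measurableSet_Ioc, inter_eq_left.2 Ioc_subset_Iic_self]
      exact memLp_const _
  have hcurve : ∀ t ≤ -1, backwardCurve x h t = backwardCurve y g (t + 1) := by
    intro t ht
    have h1 : ∫ u in t..(-1 : ℝ), h u = ∫ u in (t + 1)..(0:ℝ), g u := by
      rw [show (0:ℝ) = -1 + 1 by norm_num, ← intervalIntegral.integral_comp_add_right]
      refine intervalIntegral.integral_congr fun u hu => hle u ?_
      rw [uIcc_of_le ht] at hu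
      exact hu.2
    have h2 : ∫ u in (-1 : ℝ)..0, h u = x - y := by
      rw [intervalIntegral.integral_of_le (by norm_num),
        setIntegral_congr_fun measurableSet_Ioc hgt]
      simp
    rw [backwardCurve, backwardCurve, ← intervalIntegral.integral_add_adjacent_intervals
      (hh.intervalIntegrable_of_Iic (b := -1) (by linarith) (by norm_num))
      (hh.intervalIntegrable_of_Iic (by norm_num) le_rfl), h1, h2]
    abel
  have hcont := continuousOn_backwardCurve x fun a ha => hh.intervalIntegrable_of_Iic ha le_rfl
  refine ⟨h, hh, ?_⟩
  rw [← Iic_union_Icc_eq_Iic (show (-1 : ℝ) ≤ 0 by norm_num)]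
  refine IntegrableOn.union ?_ ?_
  · have h1 : IntegrableOn (fun t => V (backwardCurve y g (t + 1))) (Iic (-1)) :=
      hmp.integrable_comp_of_integrable hg.2
    exact h1.congr_fun (fun t ht => by simp only [hcurve t ht]) measurableSet_Iic
  · exact (hV.comp_continuousOn (hcont.mono Icc_subset_Iic_self)).integrableOn_Icc

/-- A minimizer can be chosen of class `C²` and solving Newton's equation. -/
lemma exists_contDiff_newton_of_forall_action_le [FiniteDimensional ℝ E] [CompleteSpace E]
    {V : E → ℝ} (hV : ContDiff ℝ 1 V) {x : E} {g : ℝ → E} (hg : Admissible V x g)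
    (hmin : ∀ h, Admissible V x h → action V x g ≤ action V x h) :
    ∃ γ : ℝ → E, ContDiff ℝ 2 γ ∧ γ 0 = x ∧ (∀ t ≤ 0, γ t = backwardCurve x g t) ∧
      (∀ᵐ t ∂volume.restrict (Iic 0), g t = deriv γ t) ∧
      ∀ t ≤ 0, deriv (deriv γ) t = gradient V (γ t) := by
  have hgi : ∀ a ≤ 0, IntervalIntegrable g volume a 0 := fun a ha =>
    hg.1.intervalIntegrable_of_Iic ha le_rfl
  let p : ℝ → E := fun t => gradient V (backwardCurve x g (min t 0))
  have hp : Continuous p := (continuous_gradient_of_contDiff hV).comp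
    ((continuousOn_backwardCurve x hgi).comp_continuous (by fun_prop) fun t => mem_Iic.2 (min_le_right _ _))
  have hpV : ∀ t ≤ 0, p t = gradient V (backwardCurve x g t) := fun t ht => by
    simp only [p, min_eq_left ht]
  let q : ℝ → E := fun t => ∫ u in (0:ℝ)..t, p u
  have hq : ∀ t, HasDerivAt q (p t) t := fun t => hp.integral_hasStrictDerivAt 0 t |>.hasDerivAt
  obtain ⟨c, hc⟩ := exists_ae_eq_const_add_Iic hV hg hmin hp hq hpV
  have hqc : Continuous fun t => c + q t :=
    continuous_const.add (continuous_iff_continuousAt.2 fun t => (hq t).continuousAt)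
  let γ : ℝ → E := fun t => x + ∫ u in (0:ℝ)..t, (c + q u)
  have hγ : ∀ t, HasDerivAt γ (c + q t) t := fun t =>
    (hqc.integral_hasStrictDerivAt 0 t).hasDerivAt.const_add x
  have hd : deriv γ = fun t => c + q t := funext fun t => (hγ t).deriv
  have hd2 : ∀ t, HasDerivAt (deriv γ) (p t) t := fun t => by
    rw [hd]; exact (hq t).const_add c
  have hdd : deriv (deriv γ) = p := funext fun t => (hd2 t).deriv
  have hcurve : ∀ t ≤ 0, γ t = backwardCurve x g t := fun t ht => by
    simp only [γ, backwardCurve]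
    rw [intervalIntegral.integral_symm, ← sub_eq_add_neg]
    congr 1
    apply intervalIntegral.integral_congr_ae
    filter_upwards [(ae_restrict_iff' measurableSet_Iic).1 hc] with u hu hut
    rw [uIoc_of_le ht] at hut
    exact (hu hut.2).symm
  refine ⟨γ, ?_, by simp [γ], hcurve, ?_, fun t ht => ?_⟩
  · rw [show (2 : WithTop ℕ∞) = 1 + 1 by norm_num, contDiff_succ_iff_deriv]
    refine ⟨fun t => (hγ t).differentiableAt, by simp, ?_⟩
    rw [contDiff_one_iff_deriv]
    exact ⟨fun t => (hd2 t).differentiableAt, by rw [hdd]; exact hp⟩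
  · rw [hd]; exact hc
  · rw [hdd, hpV t ht, hcurve t ht]

end Curves

section WeakKAM

variable {n : ℕ} {V : EuclideanSpace ℝ (Fin n) → ℝ} {γ g : ℝ → EuclideanSpace ℝ (Fin n)}

lemma IsACIic.eq_backwardCurve (h : IsACIic γ g) {t : ℝ} (ht : t ≤ 0) :
    γ t = backwardCurve (γ 0) g t := by
  rw [backwardCurve, eq_sub_iff_add_eq, ← h.2 t ht]

lemma IsACIic.of_memLp (hg : MemLp g 2 (volume.restrict (Iic 0))) {x : EuclideanSpace ℝ (Fin n)}
    (hγ : ∀ t ≤ 0, γ t = backwardCurve x g t) : IsACIic γ g := by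
  refine ⟨fun a ha => (intervalIntegrable_iff_integrableOn_Icc_of_le ha).1
    (hg.intervalIntegrable_of_Iic ha le_rfl), fun t ht => ?_⟩
  rw [hγ 0 le_rfl, hγ t ht, backwardCurve_zero, backwardCurve, sub_add_cancel]

lemma Admissible.integral_lag {x : EuclideanSpace ℝ (Fin n)} (hg : Admissible V x g)
    (hγ : ∀ t ≤ 0, γ t = backwardCurve x g t) :
    IntegrableOn (fun t => lag V (γ t) (g t)) (Iic 0) ∧
      ∫ t in Iic (0:ℝ), lag V (γ t) (g t) = action V x g := by
  have h1 : IntegrableOn (fun t => (1/2 : ℝ) * ‖g t‖ ^ 2) (Iic 0) :=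
    ((memLp_two_iff_integrable_sq_norm hg.1.1).1 hg.1).const_mul _
  have h2 : EqOn (fun t => (1/2 : ℝ) * ‖g t‖ ^ 2 + V (backwardCurve x g t))
      (fun t => lag V (γ t) (g t)) (Iic 0) := fun t ht => by
    simp only [lag, hγ t ht]
  refine ⟨(h1.add hg.2).congr_fun h2 measurableSet_Iic, ?_⟩
  rw [← setIntegral_congr_fun measurableSet_Iic h2, integral_add h1 hg.2, integral_const_mul, action]

lemma IsACIic.admissible (hV : Continuous V) (hVpos : ∀ x, 0 ≤ V x) (h : IsACIic γ g)
    (hlag : IntegrableOn (fun t => lag V (γ t) (g t)) (Iic 0)) : Admissible V (γ 0) g := by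
  have hmeas : AEStronglyMeasurable g (volume.restrict (Iic 0)) := by
    rw [← iUnion_Ioc_neg_nat_eq_Iic, aestronglyMeasurable_iUnion_iff]
    intro k
    have hk : -((k : ℝ) + 1) ≤ 0 := by
      have : (0:ℝ) ≤ k := k.cast_nonneg
      linarith
    exact ((h.1 _ hk).mono_set Ioc_subset_Icc_self).aestronglyMeasurable
  have hcont : ContinuousOn (backwardCurve (γ 0) g) (Iic 0) :=
    continuousOn_backwardCurve _ fun a ha =>
      (intervalIntegrable_iff_integrableOn_Icc_of_le ha).2 (h.1 a ha)
  constructor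
  · rw [memLp_two_iff_integrable_sq_norm hmeas]
    refine (hlag.const_mul 2).mono (hmeas.norm.pow 2) (ae_of_all _ fun t => ?_)
    have := hVpos (γ t)
    rw [Real.norm_of_nonneg (by positivity), Real.norm_of_nonneg (by unfold lag; positivity), lag]
    linarith
  · refine Integrable.mono hlag ((hV.comp_continuousOn hcont).aestronglyMeasurable measurableSet_Iic) ?_
    refine (ae_restrict_iff' measurableSet_Iic).2 (ae_of_all _ fun t ht => ?_)
    rw [← h.eq_backwardCurve ht]
    have := hVpos (γ t)
    rw [Real.norm_of_nonneg this, Real.norm_of_nonneg (by unfold lag; positivity), lag]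
    exact le_add_of_nonneg_left (by positivity)

lemma weakKAM_eq_action (hV : Continuous V) (hVpos : ∀ x, 0 ≤ V x) {x : EuclideanSpace ℝ (Fin n)}
    (hg : Admissible V x g) (hmin : ∀ h, Admissible V x h → action V x g ≤ action V x h) :
    weakKAM V x = action V x g := by
  refine IsLeast.csInf_eq ⟨?_, ?_⟩
  · have hlag := hg.integral_lag (γ := backwardCurve x g) fun t _ => rfl
    exact ⟨backwardCurve x g, g, IsACIic.of_memLp hg.1 fun t _ => rfl, backwardCurve_zero x g,
      hlag.1, hlag.2.symm⟩
  · rintro r ⟨γ, h, hAC, rfl, hVγ, rfl⟩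
    have hadm := hAC.admissible hV hVpos hVγ
    rw [(hadm.integral_lag fun t ht => hAC.eq_backwardCurve ht).2]
    exact hmin h hadm

end WeakKAM

/-- **Existence of a minimizer.** For every `x` there is a `C²` curve `γ : (-∞,0] → ℝⁿ` with
`γ 0 = x`, solving Newton's equation `γ'' = ∇V(γ)` on `(-∞,0]`, whose action realizes the
infimum `F(x)`. -/
theorem weakKAM_exists_minimizer {n : ℕ} (V : EuclideanSpace ℝ (Fin n) → ℝ)
    (hV : ContDiff ℝ (⊤ : ℕ∞) V) (hVpos : ∀ x, 0 < V x)
    (hσ : ∃ σ g : ℝ → EuclideanSpace ℝ (Fin n), IsACIic σ g ∧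
      IntegrableOn (fun t => lag V (σ t) (g t)) (Set.Iic 0)) :
    ∀ x : EuclideanSpace ℝ (Fin n),
      ∃ γ : ℝ → EuclideanSpace ℝ (Fin n), ContDiff ℝ 2 γ ∧ γ 0 = x ∧
        (∀ t ≤ (0:ℝ), deriv (deriv γ) t = gradient V (γ t)) ∧
        IntegrableOn (fun t => lag V (γ t) (deriv γ t)) (Set.Iic 0) ∧
        ∫ t in Set.Iic (0:ℝ), lag V (γ t) (deriv γ t) = weakKAM V x := by
  obtain ⟨σ, g₀, hσAC, hσint⟩ := hσ
  have hVnn : ∀ y, 0 ≤ V y := fun y => (hVpos y).le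
  have hV1 : ContDiff ℝ 1 V := hV.of_le (by exact_mod_cast le_top)
  intro x
  obtain ⟨g, hg, hmin⟩ := exists_admissible_forall_action_le hV.continuous hVnn x
    ((hσAC.admissible hV.continuous hVnn hσint).exists_of_endpoint hV.continuous x)
  obtain ⟨γ, hγ, hγ0, hcurve, hderiv, hnewton⟩ :=
    exists_contDiff_newton_of_forall_action_le hV1 hg hmin
  have hlag := hg.integral_lag hcurve
  have hae : (fun t => lag V (γ t) (g t)) =ᵐ[volume.restrict (Iic 0)]
      fun t => lag V (γ t) (deriv γ t) := by
    filter_upwards [hderiv] with t ht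
    rw [ht]
  refine ⟨γ, hγ, hγ0, hnewton, hlag.1.congr hae, ?_⟩
  rw [← integral_congr_ae hae, hlag.2, weakKAM_eq_action hV.continuous hVnn hg hmin]
end

section
/- The function F is locally Lipschitz on ℝⁿ. -/
open MeasureTheory Set Filter

/-- `r` is the finite action of some locally absolutely continuous curve on `(-∞,0]` ending
at `x`. -/
def IsActionAt {n : ℕ} (V : EuclideanSpace ℝ (Fin n) → ℝ) (x : EuclideanSpace ℝ (Fin n))
    (r : ℝ) : Prop :=
  ∃ γ g : ℝ → EuclideanSpace ℝ (Fin n), IsACIic γ g ∧ γ 0 = x ∧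
    IntegrableOn (fun t => lag V (γ t) (g t)) (Set.Iic 0) ∧
    r = ∫ t in Set.Iic (0:ℝ), lag V (γ t) (g t)

/-- Delaying a curve that ends at `y - T • u` by time `T` and continuing it with constant
velocity `u` gives a locally absolutely continuous curve ending at `y`. -/
lemma IsACIic.append_line {n : ℕ} {γ g : ℝ → EuclideanSpace ℝ (Fin n)} (h : IsACIic γ g)
    {T : ℝ} (hT : 0 ≤ T) {y u : EuclideanSpace ℝ (Fin n)} (hγ : γ 0 = y - T • u) :
    IsACIic (fun t => if t ≤ -T then γ (t + T) else y + t • u)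
      (fun t => if t ≤ -T then g (t + T) else u) := by
  set g' : ℝ → EuclideanSpace ℝ (Fin n) := fun t => if t ≤ -T then g (t + T) else u with hg'
  have hint : ∀ a : ℝ, a ≤ 0 → IntegrableOn g' (Icc a 0) := by
    intro a ha
    have h₁ : IntegrableOn g' (Icc (a - T) (-T)) := by
      have := ((measurePreserving_add_right volume T).integrableOn_comp_preimage
        (measurableEmbedding_addRight T)).2 (h.1 a ha)
      rw [Set.preimage_add_const_Icc, zero_sub] at this
      exact this.congr_fun (fun t ht => by simp [hg', ht.2]) measurableSet_Icc
    have h₂ : IntegrableOn g' (Ioc (-T) 0) := by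
      have : IntegrableOn (fun _ : ℝ => u) (Ioc (-T) 0) := integrableOn_const (by simp) (by simp)
      exact this.congr_fun (fun t ht => by simp [hg', ht.1]) measurableSet_Ioc
    refine (h₁.union h₂).mono_set fun t ht => ?_
    rcases le_or_gt t (-T) with h' | h'
    · exact Or.inl ⟨by linarith [ht.1], h'⟩
    · exact Or.inr ⟨h', ht.2⟩
  have hline : ∀ t : ℝ, -T ≤ t → t ≤ 0 → ∫ s in t..(0:ℝ), g' s = -t • u := by
    intro t ht ht0
    have : ∫ s in t..(0:ℝ), g' s = ∫ s in t..(0:ℝ), u := by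
      refine intervalIntegral.integral_congr_ae (ae_of_all _ fun s hs => ?_)
      rw [uIoc_of_le ht0] at hs
      simp [hg', ht.trans_lt hs.1]
    rw [this, intervalIntegral.integral_const, zero_sub]
  have hγ0 : (if (0:ℝ) ≤ -T then γ (0 + T) else y + (0:ℝ) • u) = y := by
    split_ifs with h0
    · obtain rfl : T = 0 := by linarith
      simpa using hγ
    · simp
  refine ⟨hint, fun t ht => ?_⟩
  dsimp only
  rw [hγ0]
  rcases le_or_gt t (-T) with h' | h'
  · have hadj : ∫ s in t..(0:ℝ), g' s = (∫ s in t..(-T), g' s) + ∫ s in (-T)..(0:ℝ), g' s := by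
      refine (intervalIntegral.integral_add_adjacent_intervals ?_ ?_).symm
      · rw [intervalIntegrable_iff_integrableOn_Icc_of_le h']
        exact (hint t ht).mono_set (Icc_subset_Icc_right (by linarith))
      · rw [intervalIntegrable_iff_integrableOn_Icc_of_le (by linarith)]
        exact hint _ (by linarith)
    have hshift : ∫ s in t..(-T), g' s = ∫ s in (t + T)..(0:ℝ), g s := by
      have : ∫ s in t..(-T), g' s = ∫ s in t..(-T), g (s + T) := by
        refine intervalIntegral.integral_congr_ae (ae_of_all _ fun s hs => ?_)
        rw [uIoc_of_le h'] at hs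
        simp [hg', hs.2]
      rw [this, intervalIntegral.integral_comp_add_right, neg_add_cancel]
    have hγt := h.2 (t + T) (by linarith)
    rw [if_pos h', hadj, hshift, hline (-T) le_rfl (by linarith), ← add_assoc, ← hγt, hγ]
    simp
  · rw [if_neg h'.not_ge, hline t h'.le ht]
    simp

/-- Moving the endpoint from `x` to `y` along a unit-speed segment on which `V ≤ M` increases
the action by at most `(1/2 + M) ‖y - x‖`. -/
lemma IsActionAt.exists_le_add {n : ℕ} {V : EuclideanSpace ℝ (Fin n) → ℝ}
    (hV : Continuous V) {x y : EuclideanSpace ℝ (Fin n)} {r M : ℝ}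
    (hM : ∀ z ∈ segment ℝ x y, V z ≤ M) (h : IsActionAt V x r) :
    ∃ r', IsActionAt V y r' ∧ r' ≤ r + (1 / 2 + M) * ‖y - x‖ := by
  obtain ⟨γ, g, hAC, hγ, hint, rfl⟩ := h
  set T := ‖y - x‖ with hTdef
  have hT : 0 ≤ T := norm_nonneg _
  set u := T⁻¹ • (y - x) with hu
  have hTu : T • u = y - x := by
    rcases eq_or_ne T 0 with h0 | h0
    · rw [h0, zero_smul, eq_comm, ← norm_eq_zero, ← hTdef, h0]
    · rw [hu, smul_inv_smul₀ h0]
  have hunorm : ‖u‖ ≤ 1 := by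
    rw [hu, norm_smul, norm_inv, Real.norm_of_nonneg hT]
    exact inv_mul_le_one
  have hγu : γ 0 = y - T • u := by rw [hTu, hγ]; abel
  set f : ℝ → ℝ := fun t => lag V (if t ≤ -T then γ (t + T) else y + t • u)
    (if t ≤ -T then g (t + T) else u) with hf
  have hf₁ : EqOn (fun t => lag V (γ (t + T)) (g (t + T))) f (Iic (-T)) := fun t ht => by
    simp only [hf, if_pos (mem_Iic.1 ht)]
  have hf₂ : EqOn (fun t => lag V (y + t • u) u) f (Ioc (-T) 0) := fun t ht => by
    simp only [hf, if_neg ht.1.not_ge]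
  have hpre : (fun t : ℝ => t + T) ⁻¹' Iic 0 = Iic (-T) := by
    rw [Set.preimage_add_const_Iic, zero_sub]
  have hmp := measurePreserving_add_right (volume : Measure ℝ) T
  have hint₁ : IntegrableOn f (Iic (-T)) := by
    have := (hmp.integrableOn_comp_preimage (measurableEmbedding_addRight T)).2 hint
    rw [hpre] at this
    exact this.congr_fun hf₁ measurableSet_Iic
  have hcont : Continuous fun t : ℝ => lag V (y + t • u) u := by
    unfold lag
    fun_prop
  have hint₂' : IntegrableOn (fun t : ℝ => lag V (y + t • u) u) (Ioc (-T) 0) :=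
    hcont.integrableOn_Ioc
  have hint₂ : IntegrableOn f (Ioc (-T) 0) := hint₂'.congr_fun hf₂ measurableSet_Ioc
  have hunion : Iic (-T) ∪ Ioc (-T) 0 = Iic (0:ℝ) := Iic_union_Ioc_eq_Iic (by linarith)
  refine ⟨∫ t in Iic (0:ℝ), f t, ⟨_, _, hAC.append_line hT hγu, ?_, ?_, rfl⟩, ?_⟩
  · split_ifs with h0
    · have hT0 : T = 0 := by linarith
      simpa [hT0] using hγu
    · simp
  · rw [← hunion]
    exact hint₁.union hint₂
  · have hsplit : ∫ t in Iic (0:ℝ), f t = (∫ t in Iic (0:ℝ), lag V (γ t) (g t)) +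
        ∫ t in Ioc (-T) 0, lag V (y + t • u) u := by
      rw [← hunion, setIntegral_union (Iic_disjoint_Ioc le_rfl) measurableSet_Ioc hint₁ hint₂,
        ← setIntegral_congr_fun measurableSet_Iic hf₁,
        ← setIntegral_congr_fun measurableSet_Ioc hf₂, ← hpre,
        hmp.setIntegral_preimage_emb (measurableEmbedding_addRight T)
          (fun t => lag V (γ t) (g t)), hpre, hunion]
    have hbound : ∫ t in Ioc (-T) 0, lag V (y + t • u) u ≤ ∫ _ in Ioc (-T) 0, (1 / 2 + M) := by
      refine setIntegral_mono_on hint₂' (integrableOn_const (by simp) (by simp))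
        measurableSet_Ioc fun t ht => ?_
      have hseg : y + t • u ∈ segment ℝ x y := by
        have hTpos : 0 < T := by linarith [ht.1, ht.2]
        rw [segment_symm, segment_eq_image']
        refine ⟨-t / T, ⟨div_nonneg (by linarith [ht.2]) hT, ?_⟩, ?_⟩
        · rw [div_le_one hTpos]
          linarith [ht.1]
        · dsimp only
          rw [hu, smul_smul, ← neg_sub y x, smul_neg, ← neg_smul, div_eq_mul_inv]
          congr 2
          ring
      have := hM _ hseg
      unfold lag
      nlinarith [norm_nonneg u]
    have hconst : ∫ _ in Ioc (-T) 0, (1 / 2 + M) = (1 / 2 + M) * T := by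
      simp [hT, mul_comm]
    linarith

/-- If `x` is the endpoint of a curve of finite action, then
`weakKAM V` grows at most by `(1/2 + M) ‖y - x‖` along a segment on which `V ≤ M`. -/
lemma weakKAM_le_add {n : ℕ} {V : EuclideanSpace ℝ (Fin n) → ℝ} (hV : Continuous V)
    (hVnonneg : ∀ x, 0 ≤ V x) {x y : EuclideanSpace ℝ (Fin n)} {M : ℝ}
    (hM : ∀ z ∈ segment ℝ x y, V z ≤ M) (hne : ∃ r, IsActionAt V x r) :
    weakKAM V y ≤ weakKAM V x + (1 / 2 + M) * ‖y - x‖ := by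
  rw [← sub_le_iff_le_add]
  refine le_csInf hne fun r hr => ?_
  obtain ⟨r', hr', hle⟩ := IsActionAt.exists_le_add hV hM hr
  have hbdd : BddBelow {r | IsActionAt V y r} := by
    refine ⟨0, ?_⟩
    rintro _ ⟨γ, g, -, -, -, rfl⟩
    refine integral_nonneg fun t => ?_
    have := hVnonneg (γ t)
    unfold lag
    positivity
  have : weakKAM V y ≤ r' := csInf_le hbdd hr'
  linarith

/-- **The weak KAM solution `F` is locally Lipschitz on `ℝⁿ`.** -/
theorem weakKAM_locallyLipschitz {n : ℕ} (V : EuclideanSpace ℝ (Fin n) → ℝ)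
    (hV : ContDiff ℝ (⊤ : ℕ∞) V) (hVpos : ∀ x, 0 < V x)
    (hσ : ∃ σ g : ℝ → EuclideanSpace ℝ (Fin n), IsACIic σ g ∧
      IntegrableOn (fun t => lag V (σ t) (g t)) (Set.Iic 0)) :
    LocallyLipschitz (weakKAM V) := by
  have hVc : Continuous V := hV.continuous
  obtain ⟨σ, g, hAC, hint⟩ := hσ
  have hbound : ∀ (c : EuclideanSpace ℝ (Fin n)) (R : ℝ),
      ∃ M, ∀ z ∈ Metric.closedBall c R, V z ≤ M := fun c R => by
    obtain ⟨M, hM⟩ := (isCompact_closedBall c R).bddAbove_image hVc.continuousOn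
    exact ⟨M, fun z hz => hM (mem_image_of_mem V hz)⟩
  have hne : ∀ x, ∃ r, IsActionAt V x r := fun x => by
    obtain ⟨M, hM⟩ := hbound (σ 0) (dist x (σ 0))
    have hseg : segment ℝ (σ 0) x ⊆ Metric.closedBall (σ 0) (dist x (σ 0)) :=
      (convex_closedBall _ _).segment_subset (Metric.mem_closedBall_self dist_nonneg)
        (Metric.mem_closedBall.2 le_rfl)
    obtain ⟨r, hr, -⟩ := IsActionAt.exists_le_add hVc (fun z hz => hM z (hseg hz))
      ⟨σ, g, hAC, rfl, hint, rfl⟩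
    exact ⟨r, hr⟩
  intro c
  obtain ⟨M, hM⟩ := hbound c 1
  have hM0 : 0 ≤ 1 / 2 + M := by
    have := hM c (Metric.mem_closedBall_self zero_le_one)
    linarith [hVpos c]
  refine ⟨⟨1 / 2 + M, hM0⟩, Metric.closedBall c 1, Metric.closedBall_mem_nhds c one_pos, ?_⟩
  refine LipschitzOnWith.of_le_add_mul _ fun y hy x hx => ?_
  rw [dist_eq_norm]
  exact weakKAM_le_add hVc (fun z => (hVpos z).le)
    (fun z hz => hM z ((convex_closedBall c 1).segment_subset hx hy hz)) (hne x)
end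

section
/- The function F is a viscosity solution of the Hamilton–Jacobi equation (1/2)‖∇F(x)‖² = V(x): for every x ∈ ℝⁿ and every p in the super-differential ∂⁺F(x) one has (1/2)‖p‖² ≤ V(x), and for every p in the sub-differential ∂⁻F(x) one has (1/2)‖p‖² ≥ V(x). -/
open MeasureTheory Set Filter

open scoped RealInnerProductSpace

/-- `p` belongs to the super-differential `∂⁺u(x)`:
`limsup_{y→x} (u(y) − u(x) − ⟨p, y−x⟩)/‖y−x‖ ≤ 0`. -/
def InSuperDiff {n : ℕ} (u : EuclideanSpace ℝ (Fin n) → ℝ)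
    (x p : EuclideanSpace ℝ (Fin n)) : Prop :=
  ∀ ε > (0:ℝ), ∀ᶠ y in nhdsWithin x {x}ᶜ,
    (u y - u x - ⟪p, y - x⟫) ≤ ε * ‖y - x‖

/-- `p` belongs to the sub-differential `∂⁻u(x)`:
`liminf_{y→x} (u(y) − u(x) − ⟨p, y−x⟩)/‖y−x‖ ≥ 0`. -/
def InSubDiff {n : ℕ} (u : EuclideanSpace ℝ (Fin n) → ℝ)
    (x p : EuclideanSpace ℝ (Fin n)) : Prop :=
  ∀ ε > (0:ℝ), ∀ᶠ y in nhdsWithin x {x}ᶜ,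
    -(ε * ‖y - x‖) ≤ (u y - u x - ⟪p, y - x⟫)

/-- The set of actions of admissible curves ending at `x`, whose infimum is `weakKAM V x`. -/
def curveActions {n : ℕ} (V : EuclideanSpace ℝ (Fin n) → ℝ) (x : EuclideanSpace ℝ (Fin n)) :
    Set ℝ :=
  { r : ℝ | ∃ γ g : ℝ → EuclideanSpace ℝ (Fin n), IsACIic γ g ∧ γ 0 = x ∧
    IntegrableOn (fun t => lag V (γ t) (g t)) (Set.Iic 0) ∧
    r = ∫ t in Set.Iic (0:ℝ), lag V (γ t) (g t) }

lemma weakKAM_eq_sInf {n : ℕ} (V : EuclideanSpace ℝ (Fin n) → ℝ)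
    (x : EuclideanSpace ℝ (Fin n)) : weakKAM V x = sInf (curveActions V x) := rfl

lemma lag_nonneg {n : ℕ} {V : EuclideanSpace ℝ (Fin n) → ℝ} (hVpos : ∀ x, 0 < V x)
    (x v : EuclideanSpace ℝ (Fin n)) : 0 ≤ lag V x v := by
  have := hVpos x
  unfold lag
  positivity

lemma curveActions_bddBelow {n : ℕ} {V : EuclideanSpace ℝ (Fin n) → ℝ} (hVpos : ∀ x, 0 < V x)
    (x : EuclideanSpace ℝ (Fin n)) : BddBelow (curveActions V x) := by
  refine ⟨0, ?_⟩
  rintro r ⟨γ, g, -, -, -, rfl⟩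
  exact integral_nonneg fun t => lag_nonneg hVpos _ _

section Translation

variable {E : Type*} [NormedAddCommGroup E]

lemma measurableEmbedding_add_const (s : ℝ) : MeasurableEmbedding fun t : ℝ => t + s :=
  (Homeomorph.addRight s).isClosedEmbedding.measurableEmbedding

lemma integrableOn_comp_add_const {f : ℝ → E} {S : Set ℝ} (s : ℝ) :
    IntegrableOn (fun t => f (t + s)) ((fun t => t + s) ⁻¹' S) ↔ IntegrableOn f S :=
  (measurePreserving_add_right volume s).integrableOn_comp_preimage
    (measurableEmbedding_add_const s)

lemma integrableOn_Iic_comp_add_const {f : ℝ → E} (a s : ℝ) :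
    IntegrableOn (fun t => f (t + s)) (Iic a) ↔ IntegrableOn f (Iic (a + s)) := by
  rw [← integrableOn_comp_add_const (S := Iic (a + s)) s]
  simp

lemma integrableOn_Icc_comp_add_const {f : ℝ → E} (a b s : ℝ) :
    IntegrableOn (fun t => f (t + s)) (Icc a b) ↔ IntegrableOn f (Icc (a + s) (b + s)) := by
  rw [← integrableOn_comp_add_const (S := Icc (a + s) (b + s)) s]
  simp

lemma setIntegral_Iic_comp_add_const [NormedSpace ℝ E] (f : ℝ → E) (a s : ℝ) :
    ∫ t in Iic a, f (t + s) = ∫ t in Iic (a + s), f t := by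
  rw [← (measurePreserving_add_right volume s).setIntegral_preimage_emb
    (measurableEmbedding_add_const s) f (Iic (a + s))]
  simp

end Translation

/-- Truncating an admissible curve at time `-s` removes the action accumulated on `[-s, 0]`. -/
lemma sub_mem_curveActions {n : ℕ} {V : EuclideanSpace ℝ (Fin n) → ℝ}
    {γ g : ℝ → EuclideanSpace ℝ (Fin n)} (hac : IsACIic γ g)
    (hLint : IntegrableOn (fun t => lag V (γ t) (g t)) (Iic 0)) {s : ℝ} (hs : 0 ≤ s) :
    (∫ t in Iic (0:ℝ), lag V (γ t) (g t)) - ∫ t in (-s)..0, lag V (γ t) (g t) ∈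
      curveActions V (γ (-s)) := by
  have hLint' : IntegrableOn (fun t => lag V (γ t) (g t)) (Iic (-s)) :=
    hLint.mono_set (Iic_subset_Iic.2 (by linarith))
  have hii : ∀ a b : ℝ, a ≤ b → b ≤ 0 → IntervalIntegrable g volume a b := fun a b hab hb =>
    (intervalIntegrable_iff_integrableOn_Icc_of_le hab).2
      ((hac.1 a (hab.trans hb)).mono_set (Icc_subset_Icc_right hb))
  refine ⟨fun t => γ (t + -s), fun t => g (t + -s), ⟨fun a ha => ?_, fun t ht => ?_⟩, by simp,
    ?_, ?_⟩
  · rw [integrableOn_Icc_comp_add_const]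
    exact (hac.1 (a + -s) (by linarith)).mono_set (Icc_subset_Icc_right (by linarith))
  · have h1 := hac.2 (t + -s) (by linarith)
    have h2 := hac.2 (0 + -s) (by linarith)
    rw [intervalIntegral.integral_comp_add_right]
    rw [← intervalIntegral.integral_add_adjacent_intervals
      (hii (t + -s) (0 + -s) (by linarith) (by linarith)) (hii _ _ (by linarith) le_rfl)] at h1
    rw [h2, ← add_assoc] at h1
    exact add_right_cancel h1
  · rw [integrableOn_Iic_comp_add_const (f := fun t => lag V (γ t) (g t))]
    simpa using hLint'
  · rw [setIntegral_Iic_comp_add_const (fun t => lag V (γ t) (g t)), zero_add,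
      ← intervalIntegral.integral_Iic_sub_Iic hLint' hLint]
    ring

/-- Extending an admissible curve by a segment with constant velocity `v` during time `s`. -/
lemma add_mem_curveActions {n : ℕ} {V : EuclideanSpace ℝ (Fin n) → ℝ} (hV : Continuous V)
    {y : EuclideanSpace ℝ (Fin n)} {r : ℝ} (hr : r ∈ curveActions V y)
    (v : EuclideanSpace ℝ (Fin n)) {s : ℝ} (hs : 0 ≤ s) :
    r + ∫ t in (-s)..0, lag V (y + (t + s) • v) v ∈ curveActions V (y + s • v) := by
  obtain ⟨γ, g, hac, hy, hLint, rfl⟩ := hr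
  let γ' : ℝ → EuclideanSpace ℝ (Fin n) := fun t => if t ≤ -s then γ (t + s) else y + (t + s) • v
  let g' : ℝ → EuclideanSpace ℝ (Fin n) := fun t => if t ≤ -s then g (t + s) else v
  have hγ'_left : ∀ t, t ≤ -s → γ' t = γ (t + s) := fun t ht => if_pos ht
  have hγ'_right : ∀ t, -s ≤ t → γ' t = y + (t + s) • v := fun t ht => by
    rcases ht.eq_or_lt with rfl | h
    · simp [γ', hy]
    · exact if_neg h.not_ge
  have hg'_left : ∀ t, t ≤ -s → g' t = g (t + s) := fun t ht => if_pos ht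
  have hg'_right : ∀ t, -s < t → g' t = v := fun t ht => if_neg ht.not_ge
  have hint_left : IntegrableOn (fun t => lag V (γ' t) (g' t)) (Iic (-s)) := by
    have := (integrableOn_Iic_comp_add_const (f := fun t => lag V (γ t) (g t)) (-s) s).2
      (by simpa using hLint)
    refine this.congr_fun (fun t ht => ?_) measurableSet_Iic
    simp only [hγ'_left t ht, hg'_left t ht]
  have hseg : EqOn (fun t => lag V (y + (t + s) • v) v) (fun t => lag V (γ' t) (g' t))
      (Ioc (-s) 0) := fun t ht => by
    simp only [hγ'_right t ht.1.le, hg'_right t ht.1]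
  have hint_right : IntegrableOn (fun t => lag V (γ' t) (g' t)) (Ioc (-s) 0) := by
    have hc : Continuous fun t : ℝ => lag V (y + (t + s) • v) v := by
      unfold lag
      fun_prop
    exact (hc.integrableOn_Ioc).congr_fun hseg measurableSet_Ioc
  have hunion : Iic (-s) ∪ Ioc (-s) 0 = Iic (0:ℝ) := Iic_union_Ioc_eq_Iic (by linarith)
  have hg'_int_left : ∀ a, IntegrableOn g' (Icc a (-s)) := fun a => by
    have h : IntegrableOn g (Icc (a + s) (-s + s)) := by
      rw [neg_add_cancel]
      rcases le_total (a + s) 0 with ha | ha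
      · exact hac.1 _ ha
      · exact (hac.1 0 le_rfl).mono_set (Icc_subset_Icc_left ha)
    exact ((integrableOn_Icc_comp_add_const _ _ s).2 h).congr_fun
      (fun t ht => (hg'_left t ht.2).symm) measurableSet_Icc
  have hg'_int_right : IntegrableOn g' (Ioc (-s) 0) :=
    (integrableOn_const (by simp)).congr_fun (fun t ht => (hg'_right t ht.1).symm)
      measurableSet_Ioc
  have hg'_seg : ∀ t, -s ≤ t → t ≤ 0 → ∫ u in t..(0:ℝ), g' u = (-t) • v := fun t hst ht => by
    rw [intervalIntegral.integral_congr_ae (g := fun _ => v)]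
    · simp
    · rw [uIoc_of_le ht]
      exact ae_of_all _ fun u hu => hg'_right u (hst.trans_lt hu.1)
  refine ⟨γ', g', ⟨fun a ha => ?_, fun t ht => ?_⟩, ?_, ?_, ?_⟩
  · refine ((hg'_int_left a).union hg'_int_right).mono_set fun t ht => ?_
    rcases le_or_gt t (-s) with h | h
    · exact Or.inl ⟨ht.1, h⟩
    · exact Or.inr ⟨h, ht.2⟩
  · rw [hγ'_right 0 (by linarith), zero_add]
    rcases le_total (-s) t with h | h
    · rw [hγ'_right t h, hg'_seg t h ht, add_assoc, ← add_smul]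
      congr 2
      ring
    · have h0 := hac.2 (t + s) (by linarith)
      rw [← intervalIntegral.integral_add_adjacent_intervals (b := -s)
        ((intervalIntegrable_iff_integrableOn_Icc_of_le h).2 (hg'_int_left t))
        ((intervalIntegrable_iff_integrableOn_Ioc_of_le (by linarith)).2 hg'_int_right),
        hg'_seg (-s) le_rfl (by linarith), neg_neg, ← add_assoc, hγ'_left t h]
      congr 1
      rw [← hy, h0]
      congr 1
      rw [intervalIntegral.integral_congr_ae (f := g') (g := fun u => g (u + s)),
        intervalIntegral.integral_comp_add_right, neg_add_cancel]
      rw [uIoc_of_le h]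
      exact ae_of_all _ fun u hu => hg'_left u hu.2
  · rw [hγ'_right 0 (by linarith), zero_add]
  · rw [← hunion]
    exact hint_left.union hint_right
  · rw [← hunion, setIntegral_union (Iic_disjoint_Ioc le_rfl) measurableSet_Ioc hint_left
      hint_right, hunion]
    congr 1
    · have h := setIntegral_Iic_comp_add_const (fun t => lag V (γ t) (g t)) (-s) s
      rw [neg_add_cancel] at h
      rw [← h]
      refine setIntegral_congr_fun measurableSet_Iic fun t ht => ?_
      simp only [hγ'_left t ht, hg'_left t ht]
    · rw [intervalIntegral.integral_of_le (by linarith)]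
      exact setIntegral_congr_fun measurableSet_Ioc hseg

lemma curveActions_nonempty {n : ℕ} {V : EuclideanSpace ℝ (Fin n) → ℝ} (hV : Continuous V)
    (hσ : ∃ σ g : ℝ → EuclideanSpace ℝ (Fin n), IsACIic σ g ∧
      IntegrableOn (fun t => lag V (σ t) (g t)) (Set.Iic 0)) (x : EuclideanSpace ℝ (Fin n)) :
    (curveActions V x).Nonempty := by
  obtain ⟨σ, g, hac, hLint⟩ := hσ
  have h := add_mem_curveActions hV (y := σ 0) ⟨σ, g, hac, rfl, hLint, rfl⟩ (x - σ 0) zero_le_one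
  rw [one_smul, add_sub_cancel] at h
  exact ⟨_, h⟩

/-- Along a segment on which `V ≤ M`, the growth of `weakKAM V` is bounded by the action. -/
lemma weakKAM_add_smul_le {n : ℕ} {V : EuclideanSpace ℝ (Fin n) → ℝ} (hV : Continuous V)
    (hVpos : ∀ x, 0 < V x) {y : EuclideanSpace ℝ (Fin n)} (hne : (curveActions V y).Nonempty)
    (v : EuclideanSpace ℝ (Fin n)) {s M : ℝ} (hs : 0 ≤ s)
    (hM : ∀ t ∈ Icc 0 s, V (y + t • v) ≤ M) :
    weakKAM V (y + s • v) ≤ weakKAM V y + s * ((1/2 : ℝ) * ‖v‖ ^ 2 + M) := by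
  have hseg : ∫ t in (-s)..0, lag V (y + (t + s) • v) v ≤ s * ((1/2 : ℝ) * ‖v‖ ^ 2 + M) := by
    have hc : Continuous fun t : ℝ => lag V (y + (t + s) • v) v := by
      unfold lag
      fun_prop
    calc ∫ t in (-s)..0, lag V (y + (t + s) • v) v
        ≤ ∫ _ in (-s)..0, ((1/2 : ℝ) * ‖v‖ ^ 2 + M) := by
          refine intervalIntegral.integral_mono_on (by linarith) (hc.intervalIntegrable _ _)
            intervalIntegrable_const fun t ht => ?_
          have := hM (t + s) ⟨by linarith [ht.1], by linarith [ht.2]⟩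
          unfold lag
          linarith
      _ = _ := by rw [intervalIntegral.integral_const, smul_eq_mul, zero_sub, neg_neg]
  rw [← sub_le_iff_le_add, weakKAM_eq_sInf V y]
  refine le_csInf hne fun r hr => ?_
  have := csInf_le (curveActions_bddBelow hVpos _) (add_mem_curveActions hV hr v hs)
  rw [weakKAM_eq_sInf]
  linarith

/-- A bound on the displacement of an admissible curve in terms of its action. -/
lemma norm_sub_le_of_isACIic {n : ℕ} {V : EuclideanSpace ℝ (Fin n) → ℝ}
    (hVpos : ∀ x, 0 < V x) {γ g : ℝ → EuclideanSpace ℝ (Fin n)} (hac : IsACIic γ g)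
    (hLint : IntegrableOn (fun t => lag V (γ t) (g t)) (Iic 0)) {c t : ℝ} (hc : 0 < c)
    (ht : t ≤ 0) :
    ‖γ t - γ 0‖ ≤ -t / (2 * c) + c * ∫ u in Iic (0:ℝ), lag V (γ u) (g u) := by
  have hL : IntervalIntegrable (fun u => lag V (γ u) (g u)) volume t 0 :=
    (intervalIntegrable_iff_integrableOn_Ioc_of_le ht).2 (hLint.mono_set Ioc_subset_Iic_self)
  have hg : IntervalIntegrable g volume t 0 :=
    (intervalIntegrable_iff_integrableOn_Icc_of_le ht).2 (hac.1 t ht)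
  calc ‖γ t - γ 0‖ = ‖∫ u in t..(0:ℝ), g u‖ := by
        rw [norm_sub_rev, sub_eq_of_eq_add' (hac.2 t ht)]
    _ ≤ ∫ u in t..(0:ℝ), ‖g u‖ := intervalIntegral.norm_integral_le_integral_norm ht
    _ ≤ ∫ u in t..(0:ℝ), (1 / (2 * c) + c * lag V (γ u) (g u)) := by
        refine intervalIntegral.integral_mono_on ht hg.norm
          (intervalIntegrable_const.add (hL.const_mul c)) fun u _ => ?_
        have h1 : 1 / (2 * c) + c * ((1/2 : ℝ) * ‖g u‖ ^ 2) - ‖g u‖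
            = (c * ‖g u‖ - 1) ^ 2 / (2 * c) := by
          field_simp
          ring
        have h2 : 0 ≤ (c * ‖g u‖ - 1) ^ 2 / (2 * c) := by positivity
        have h3 := mul_pos hc (hVpos (γ u))
        unfold lag
        linarith
    _ = -t / (2 * c) + c * ∫ u in t..(0:ℝ), lag V (γ u) (g u) := by
        rw [intervalIntegral.integral_add intervalIntegrable_const (hL.const_mul c),
          intervalIntegral.integral_const_mul, intervalIntegral.integral_const, smul_eq_mul]
        ring
    _ ≤ _ := by
        gcongr
        rw [intervalIntegral.integral_of_le ht]
        exact setIntegral_mono_set hLint (ae_of_all _ fun u => lag_nonneg hVpos _ _)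
          Ioc_subset_Iic_self.eventuallyLE

/-- Super-differential half: `weakKAM V` is a viscosity subsolution. -/
lemma half_norm_sq_le_of_inSuperDiff {n : ℕ} {V : EuclideanSpace ℝ (Fin n) → ℝ}
    (hV : Continuous V) (hVpos : ∀ x, 0 < V x) (hne : ∀ y, (curveActions V y).Nonempty)
    {x p : EuclideanSpace ℝ (Fin n)} (hp : InSuperDiff (weakKAM V) x p) :
    (1/2 : ℝ) * ‖p‖ ^ 2 ≤ V x := by
  refine le_of_forall_pos_le_add fun κ hκ => ?_
  obtain ⟨ε, hε, hεκ⟩ : ∃ ε > 0, ε * ‖p‖ ≤ κ / 2 := by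
    refine ⟨κ / 2 / (‖p‖ + 1), by positivity, ?_⟩
    rw [div_mul_eq_mul_div, div_le_iff₀ (by positivity)]
    nlinarith [norm_nonneg p]
  have hsup : ∀ᶠ y in nhds x, weakKAM V y - weakKAM V x - ⟪p, y - x⟫ ≤ ε * ‖y - x‖ := by
    filter_upwards [eventually_nhdsWithin_iff.1 (hp ε hε)] with y hy
    by_cases h : y = x
    · simp [h]
    · exact hy h
  have hVx : ∀ᶠ y in nhds x, V y < V x + κ / 2 :=
    hV.continuousAt.eventually_lt continuousAt_const (by linarith)
  obtain ⟨ρ, hρ, hball⟩ := Metric.eventually_nhds_iff_ball.1 (hsup.and hVx)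
  obtain ⟨s, hs, hsρ⟩ : ∃ s > 0, s * ‖p‖ < ρ := by
    refine ⟨ρ / (‖p‖ + 1), by positivity, ?_⟩
    rw [div_mul_eq_mul_div, div_lt_iff₀ (by positivity)]
    nlinarith [norm_nonneg p]
  have hmem : ∀ t ∈ Icc 0 s, x - s • p + t • p ∈ Metric.ball x ρ := fun t ht => by
    have : x - s • p + t • p - x = (t - s) • p := by
      rw [sub_smul]
      abel
    rw [mem_ball_iff_norm, this, norm_smul, Real.norm_eq_abs, abs_sub_comm,
      abs_of_nonneg (by linarith [ht.2])]
    exact (mul_le_mul_of_nonneg_right (by linarith [ht.1]) (norm_nonneg p)).trans_lt hsρ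
  have h1 := weakKAM_add_smul_le hV hVpos (hne (x - s • p)) p hs.le
    fun t ht => (hball _ (hmem t ht)).2.le
  rw [sub_add_cancel] at h1
  have h2 := (hball (x - s • p) (by simpa using hmem 0 ⟨le_rfl, hs.le⟩)).1
  rw [sub_sub_cancel_left, inner_neg_right, inner_smul_right, real_inner_self_eq_norm_sq,
    norm_neg, norm_smul, Real.norm_eq_abs, abs_of_pos hs] at h2
  have h3 : s * ((1/2 : ℝ) * ‖p‖ ^ 2) ≤ s * (V x + κ / 2 + ε * ‖p‖) := by linarith
  linarith [le_of_mul_le_mul_left h3 hs]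

/-- Sub-differential half: `weakKAM V` is a viscosity supersolution. -/
lemma le_half_norm_sq_of_inSubDiff {n : ℕ} {V : EuclideanSpace ℝ (Fin n) → ℝ}
    (hV : Continuous V) (hVpos : ∀ x, 0 < V x)
    {x p : EuclideanSpace ℝ (Fin n)} (hne : (curveActions V x).Nonempty)
    (hp : InSubDiff (weakKAM V) x p) :
    V x ≤ (1/2 : ℝ) * ‖p‖ ^ 2 := by
  suffices h : ∀ ε > 0, V x ≤ (1/2 : ℝ) * (‖p‖ + ε) ^ 2 + 2 * ε by
    have hlim : Tendsto (fun ε : ℝ => (1/2 : ℝ) * (‖p‖ + ε) ^ 2 + 2 * ε) (nhdsWithin 0 (Ioi 0))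
        (nhds ((1/2 : ℝ) * ‖p‖ ^ 2)) := by
      have hc : Continuous fun ε : ℝ => (1/2 : ℝ) * (‖p‖ + ε) ^ 2 + 2 * ε := by fun_prop
      simpa using (hc.tendsto 0).mono_left nhdsWithin_le_nhds
    exact ge_of_tendsto hlim (eventually_mem_nhdsWithin.mono h)
  intro ε hε
  have hsub : ∀ᶠ y in nhds x, -(ε * ‖y - x‖) ≤ weakKAM V y - weakKAM V x - ⟪p, y - x⟫ := by
    filter_upwards [eventually_nhdsWithin_iff.1 (hp ε hε)] with y hy
    by_cases h : y = x
    · simp [h]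
    · exact hy h
  have hVx : ∀ᶠ y in nhds x, V x - ε < V y :=
    continuousAt_const.eventually_lt hV.continuousAt (by linarith)
  obtain ⟨ρ, hρ, hball⟩ := Metric.eventually_nhds_iff_ball.1 (hsub.and hVx)
  have hF : 0 ≤ weakKAM V x := Real.sInf_nonneg (by
    rintro r ⟨γ, g, -, -, -, rfl⟩
    exact integral_nonneg fun t => lag_nonneg hVpos _ _)
  obtain ⟨c, hc, hcρ⟩ : ∃ c > 0, c * (weakKAM V x + ε) ≤ ρ / 2 :=
    ⟨ρ / 2 / (weakKAM V x + ε), by positivity, (div_mul_cancel₀ _ (by positivity)).le⟩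
  obtain ⟨s, hs, hs1, hsρ⟩ : ∃ s > 0, s ≤ 1 ∧ s / (2 * c) < ρ / 2 := by
    refine ⟨min 1 (c * ρ / 2), by positivity, min_le_left _ _, ?_⟩
    rw [div_lt_iff₀ (by positivity)]
    have := min_le_right 1 (c * ρ / 2)
    nlinarith [mul_pos hc hρ]
  obtain ⟨r, ⟨γ, g, hac, hx, hLint, rfl⟩, hr⟩ :=
    exists_lt_of_csInf_lt hne (lt_add_of_pos_right (weakKAM V x) (mul_pos hε hs))
  have hs0 : -s ≤ 0 := by linarith
  have hmem : ∀ t ∈ Icc (-s) 0, γ t ∈ Metric.ball x ρ := fun t ht => by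
    rw [mem_ball_iff_norm, ← hx]
    have hA : c * ∫ u in Iic (0:ℝ), lag V (γ u) (g u) ≤ c * (weakKAM V x + ε) := by
      gcongr
      nlinarith
    have hT : -t / (2 * c) ≤ s / (2 * c) := by
      gcongr
      linarith [ht.1]
    linarith [norm_sub_le_of_isACIic hVpos hac hLint hc ht.2]
  have hL : IntervalIntegrable (fun u => lag V (γ u) (g u)) volume (-s) 0 :=
    (intervalIntegrable_iff_integrableOn_Ioc_of_le hs0).2 (hLint.mono_set Ioc_subset_Iic_self)
  have hg : IntervalIntegrable g volume (-s) 0 :=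
    (intervalIntegrable_iff_integrableOn_Icc_of_le hs0).2 (hac.1 _ hs0)
  have hpg : IntervalIntegrable (fun u => ⟪p, g u⟫) volume (-s) 0 :=
    ⟨hg.1.const_inner p, hg.2.const_inner p⟩
  have hlow : s * (V x - ε - (1/2 : ℝ) * (‖p‖ + ε) ^ 2) ≤
      (∫ u in (-s)..0, lag V (γ u) (g u)) - (∫ u in (-s)..0, ⟪p, g u⟫)
        - ε * ∫ u in (-s)..0, ‖g u‖ := by
    rw [← intervalIntegral.integral_const_mul, ← intervalIntegral.integral_sub hL hpg,
      ← intervalIntegral.integral_sub (hL.sub hpg) (hg.norm.const_mul ε)]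
    calc s * (V x - ε - (1/2 : ℝ) * (‖p‖ + ε) ^ 2)
        = ∫ _ in (-s)..0, (V x - ε - (1/2 : ℝ) * (‖p‖ + ε) ^ 2) := by
          rw [intervalIntegral.integral_const, smul_eq_mul, zero_sub, neg_neg]
      _ ≤ _ := by
        refine intervalIntegral.integral_mono_on hs0 intervalIntegrable_const
          ((hL.sub hpg).sub (hg.norm.const_mul ε)) fun u hu => ?_
        have h1 := (hball _ (hmem u hu)).2
        have h2 := real_inner_le_norm p (g u)
        unfold lag
        nlinarith [sq_nonneg (‖g u‖ - (‖p‖ + ε))]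
  have hdisp : γ (-s) - x = -∫ u in (-s)..0, g u := by
    rw [← hx, hac.2 (-s) hs0]
    abel
  have hinner : ⟪p, γ (-s) - x⟫ = -∫ u in (-s)..0, ⟪p, g u⟫ := by
    rw [hdisp, inner_neg_right]
    congr 1
    exact (((innerSL ℝ p).intervalIntegral_comp_comm hg)).symm
  have hnorm : ‖γ (-s) - x‖ ≤ ∫ u in (-s)..0, ‖g u‖ := by
    rw [hdisp, norm_neg]
    exact intervalIntegral.norm_integral_le_integral_norm hs0
  have hFs : weakKAM V (γ (-s)) ≤ _ :=
    csInf_le (curveActions_bddBelow hVpos _) (sub_mem_curveActions hac hLint hs.le)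
  have hsd := (hball _ (hmem (-s) ⟨le_rfl, hs0⟩)).1
  rw [hinner] at hsd
  have hε' := mul_le_mul_of_nonneg_left hnorm hε.le
  have hfin : s * (V x - ε - (1/2 : ℝ) * (‖p‖ + ε) ^ 2) ≤ s * ε := by linarith
  linarith [le_of_mul_le_mul_left hfin hs]

/-- **`F` is a viscosity solution of the Hamilton–Jacobi equation `(1/2)‖∇F‖² = V`.** -/
theorem weakKAM_viscosity_solution {n : ℕ} (V : EuclideanSpace ℝ (Fin n) → ℝ)
    (hV : ContDiff ℝ (⊤ : ℕ∞) V) (hVpos : ∀ x, 0 < V x)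
    (hσ : ∃ σ g : ℝ → EuclideanSpace ℝ (Fin n), IsACIic σ g ∧
      IntegrableOn (fun t => lag V (σ t) (g t)) (Set.Iic 0)) :
    ∀ x p : EuclideanSpace ℝ (Fin n),
      (InSuperDiff (weakKAM V) x p → (1/2 : ℝ) * ‖p‖ ^ 2 ≤ V x) ∧
      (InSubDiff (weakKAM V) x p → V x ≤ (1/2 : ℝ) * ‖p‖ ^ 2) := by
  have hVc : Continuous V := hV.continuous
  have hne := curveActions_nonempty hVc hσ
  exact fun x p => ⟨half_norm_sq_le_of_inSuperDiff hVc hVpos hne,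
    le_half_norm_sq_of_inSubDiff hVc hVpos (hne x)⟩
end

section
/- Let I ⊆ ℝ be an interval, t₀ ∈ I, and let v₁, w₂, …, w_n : I → ℝⁿ be C¹ maps such that (v₁(t), w₂(t), …, w_n(t)) is an orthonormal basis of ℝⁿ for every t ∈ I. Then there exist C¹ maps v₂, …, v_n : I → ℝⁿ such that (v₁(t), v₂(t), …, v_n(t)) is an orthonormal basis of ℝⁿ for every t ∈ I, v_i(t₀) = w_i(t₀) for i = 2, …, n, and for every i = 2, …, n and t ∈ I the derivative v_i'(t) is a scalar multiple of v₁(t). -/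
open Set

/-- **Global existence for linear ODEs.** The linear equation `x' = A(t) x` with continuous
coefficients has a solution on the whole line with any prescribed initial value. The solution is
the fixed point of the Picard map, a contraction for the sup norm weighted by
`cosh (2 ∫ ‖A‖)`. -/
theorem exists_forall_hasDerivAt_linear {E : Type*} [NormedAddCommGroup E] [NormedSpace ℝ E]
    [CompleteSpace E] {A : ℝ → E →L[ℝ] E} (hA : Continuous A) (t₀ : ℝ) (x₀ : E) :
    ∃ x : ℝ → E, x t₀ = x₀ ∧ ∀ t, HasDerivAt x (A t (x t)) t := by
  set h : ℝ → ℝ := fun t => ∫ s in t₀..t, 2 * ‖A s‖ with h_def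
  have hh : ∀ t, HasDerivAt h (2 * ‖A t‖) t := fun t =>
    Continuous.integral_hasStrictDerivAt (by fun_prop) t₀ t |>.hasDerivAt
  have hh₀ : h t₀ = 0 := by simp [h_def]
  have h_cont : Continuous h := continuous_iff_continuousAt.2 fun t => (hh t).continuousAt
  have hcosh : Continuous fun t => Real.cosh (h t) := Real.continuous_cosh.comp h_cont
  set P : (ℝ → E) → ℝ → E := fun u t => ∫ s in t₀..t, A s (Real.cosh (h s) • u s) with P_def
  have P_integrand {u : ℝ → E} (hu : Continuous u) :
      Continuous fun s => A s (Real.cosh (h s) • u s) := hA.clm_apply (hcosh.smul hu)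
  have P_deriv {u : ℝ → E} (hu : Continuous u) (t : ℝ) :
      HasDerivAt (P u) (A t (Real.cosh (h t) • u t)) t :=
    (P_integrand hu).integral_hasStrictDerivAt t₀ t |>.hasDerivAt
  have P_cont {u : ℝ → E} (hu : Continuous u) : Continuous (P u) :=
    continuous_iff_continuousAt.2 fun t => (P_deriv hu t).continuousAt
  have P_sub {u v : ℝ → E} (hu : Continuous u) (hv : Continuous v) (t : ℝ) :
      P u t - P v t = P (fun s => u s - v s) t := by
    simp only [P_def, smul_sub, map_sub]
    exact (intervalIntegral.integral_sub ((P_integrand hu).intervalIntegrable _ _)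
      ((P_integrand hv).intervalIntegrable _ _)).symm
  have P_bound {u : ℝ → E} {C : ℝ} (hC : ∀ s, ‖u s‖ ≤ C) (t : ℝ) :
      ‖(Real.cosh (h t))⁻¹ • P u t‖ ≤ C / 2 := by
    have hC₀ : 0 ≤ C := (norm_nonneg _).trans (hC t₀)
    have g_cont : Continuous fun s => C / 2 * (Real.cosh (h s) * (2 * ‖A s‖)) := by fun_prop
    have hint : ∫ s in t₀..t, C / 2 * (Real.cosh (h s) * (2 * ‖A s‖))
        = C / 2 * Real.sinh (h t) := by
      rw [intervalIntegral.integral_eq_sub_of_hasDerivAt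
        (f := fun s => C / 2 * Real.sinh (h s)) (fun s _ => ((hh s).sinh).const_mul _)
        (g_cont.intervalIntegrable _ _)]
      simp [hh₀]
    have hle : ‖P u t‖ ≤ |C / 2 * Real.sinh (h t)| := by
      rw [← hint]
      refine intervalIntegral.norm_integral_le_abs_of_norm_le
        (Filter.Eventually.of_forall fun s => ?_) (g_cont.intervalIntegrable _ _)
      calc ‖A s (Real.cosh (h s) • u s)‖
          ≤ ‖A s‖ * (Real.cosh (h s) * C) := by
            refine (A s).le_opNorm_of_le ?_
            rw [norm_smul, Real.norm_of_nonneg (Real.cosh_pos _).le]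
            gcongr
            exact hC s
        _ = C / 2 * (Real.cosh (h s) * (2 * ‖A s‖)) := by ring
    have hsc : |Real.sinh (h t)| ≤ Real.cosh (h t) :=
      abs_le_of_sq_le_sq (by rw [Real.cosh_sq (h t)]; linarith) (Real.cosh_pos _).le
    rw [norm_smul, norm_inv, Real.norm_of_nonneg (Real.cosh_pos _).le,
      inv_mul_le_iff₀ (Real.cosh_pos _)]
    rw [abs_mul, abs_of_nonneg (by positivity : 0 ≤ C / 2)] at hle
    calc ‖P u t‖ ≤ C / 2 * |Real.sinh (h t)| := hle
      _ ≤ C / 2 * Real.cosh (h t) := by gcongr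
      _ = Real.cosh (h t) * (C / 2) := mul_comm _ _
  let Φ : BoundedContinuousFunction ℝ E → BoundedContinuousFunction ℝ E := fun y =>
    .ofNormedAddCommGroup (fun t => (Real.cosh (h t))⁻¹ • (x₀ + P y t))
      ((hcosh.inv₀ fun t => (Real.cosh_pos _).ne').smul
        (continuous_const.add (P_cont y.continuous)))
      (‖x₀‖ + ‖y‖ / 2) fun t => by
        rw [smul_add]
        refine (norm_add_le _ _).trans (add_le_add ?_ (P_bound y.norm_coe_le_norm t))
        rw [norm_smul, norm_inv, Real.norm_of_nonneg (Real.cosh_pos _).le]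
        exact mul_le_of_le_one_left (norm_nonneg _) (inv_le_one_of_one_le₀ (Real.one_le_cosh _))
  have hΦ : ContractingWith (1 / 2) Φ := by
    refine ⟨by norm_num, LipschitzWith.of_dist_le_mul fun y z => ?_⟩
    refine (BoundedContinuousFunction.dist_le (by positivity)).2 fun t => ?_
    have key : Φ y t - Φ z t = (Real.cosh (h t))⁻¹ • P (fun s => y s - z s) t := by
      rw [← P_sub y.continuous z.continuous]
      simp only [Φ, BoundedContinuousFunction.coe_ofNormedAddCommGroup]
      rw [← smul_sub, add_sub_add_left_eq_sub]
    rw [dist_eq_norm, key]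
    refine (P_bound (C := dist y z) (fun s => ?_) t).trans_eq ?_
    · rw [← dist_eq_norm]
      exact BoundedContinuousFunction.dist_coe_le_dist s
    · push_cast
      ring
  set y := ContractingWith.fixedPoint Φ hΦ
  have hy (t : ℝ) : Real.cosh (h t) • y t = x₀ + P y t := by
    have : Φ y t = y t := congrArg (fun z : BoundedContinuousFunction ℝ E => z t)
      hΦ.fixedPoint_isFixedPt
    rw [← this]
    exact smul_inv_smul₀ (Real.cosh_pos _).ne' _
  refine ⟨fun t => x₀ + P y t, by simp [P_def], fun t => ?_⟩
  beta_reduce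
  rw [← hy]
  exact (P_deriv y.continuous t).const_add x₀

/-- A real function whose derivative vanishes on an order-connected set is constant there. -/
theorem Set.OrdConnected.eq_of_hasDerivAt_zero {I : Set ℝ} (hI : I.OrdConnected) {f : ℝ → ℝ}
    (hf : ∀ t ∈ I, HasDerivAt f 0 t) {s t : ℝ} (hs : s ∈ I) (ht : t ∈ I) : f t = f s := by
  have := hI.convex.norm_image_sub_le_of_norm_hasDerivWithin_le (C := 0)
    (fun x hx => (hf x hx).hasDerivWithinAt) (by simp) hs ht
  simpa [sub_eq_zero] using this

/-- An orthonormal family with a vector prepended, in terms of inner products. -/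
theorem orthonormal_fin_cons_iff {E : Type*} [NormedAddCommGroup E] [InnerProductSpace ℝ E]
    {n : ℕ} {a : E} {b : Fin n → E} :
    Orthonormal ℝ (Fin.cons a b : Fin (n + 1) → E) ↔
      inner ℝ a a = 1 ∧ (∀ j, inner ℝ (b j) a = 0) ∧
        ∀ i j, inner ℝ (b i) (b j) = if i = j then 1 else 0 := by
  rw [orthonormal_iff_ite]
  simp only [Fin.forall_fin_succ, Fin.cons_zero, Fin.cons_succ, Fin.succ_inj, if_true,
    Fin.succ_ne_zero, (Fin.succ_ne_zero _).symm, if_false, forall_and]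
  constructor
  · rintro ⟨⟨ha, hb⟩, -, hbb⟩
    exact ⟨ha, hb, hbb⟩
  · rintro ⟨ha, hb, hbb⟩
    exact ⟨⟨ha, hb⟩, fun j => by rw [real_inner_comm, hb], hbb⟩

/-- **Existence of an adapted orthonormal frame.** Given a `C¹` orthonormal moving frame
`(v₁, w₂, …, w_n)` of `ℝⁿ` along an interval `I`, there is a `C¹` orthonormal frame
`(v₁, v₂, …, v_n)` along `I` agreeing with `(v₁, w₂, …, w_n)` at `t₀` and such that each
derivative `vᵢ'(t)` (`i ≥ 2`) is a scalar multiple of `v₁(t)`. -/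
theorem exists_adapted_frame {n : ℕ} (I : Set ℝ) (hI : I.OrdConnected)
    (t₀ : ℝ) (ht₀ : t₀ ∈ I)
    (v1 : ℝ → EuclideanSpace ℝ (Fin (n + 1)))
    (w : Fin n → ℝ → EuclideanSpace ℝ (Fin (n + 1)))
    (hv1 : ContDiff ℝ 1 v1) (hw : ∀ j, ContDiff ℝ 1 (w j))
    (horth : ∀ t ∈ I, Orthonormal ℝ
      (Fin.cons (v1 t) (fun j => w j t) : Fin (n + 1) → EuclideanSpace ℝ (Fin (n + 1)))) :
    ∃ v : Fin n → ℝ → EuclideanSpace ℝ (Fin (n + 1)),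
      (∀ j, ContDiff ℝ 1 (v j)) ∧
      (∀ t ∈ I, Orthonormal ℝ
        (Fin.cons (v1 t) (fun j => v j t) : Fin (n + 1) → EuclideanSpace ℝ (Fin (n + 1)))) ∧
      (∀ j, v j t₀ = w j t₀) ∧
      (∀ j, ∀ t ∈ I, ∃ c : ℝ, deriv (v j) t = c • v1 t) := by
  simp only [orthonormal_fin_cons_iff] at horth ⊢
  have hd1 : Continuous (deriv v1) := hv1.continuous_deriv le_rfl
  have hv1' (t : ℝ) : HasDerivAt v1 (deriv v1 t) t :=
    (hv1.differentiable one_ne_zero t).hasDerivAt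
  -- The frame solves `x' = -⟪v₁', x⟫ v₁`.
  have hA : Continuous fun t => -(innerSL ℝ (deriv v1 t)).smulRight (v1 t) :=
    (((ContinuousLinearMap.smulRightL ℝ _ _).continuous.comp
      ((innerSL ℝ).continuous.comp hd1)).clm_apply hv1.continuous).neg
  choose v hv₀ hv using fun j => exists_forall_hasDerivAt_linear hA t₀ (w j t₀)
  replace hv (j : Fin n) (t : ℝ) :
      HasDerivAt (v j) (-(inner ℝ (deriv v1 t) (v j t)) • v1 t) t := by
    simpa using hv j t
  have hv_cont (j : Fin n) : Continuous (v j) :=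
    continuous_iff_continuousAt.2 fun t => (hv j t).continuousAt
  have hperp (j : Fin n) (t : ℝ) (ht : t ∈ I) : inner ℝ (v j t) (v1 t) = 0 := by
    rw [hI.eq_of_hasDerivAt_zero (f := fun t => inner ℝ (v j t) (v1 t)) (fun s hs => ?_) ht₀ ht,
      hv₀, (horth t₀ ht₀).2.1]
    refine ((hv j s).inner ℝ (hv1' s)).congr_deriv ?_
    rw [inner_smul_left, (horth s hs).1, real_inner_comm (deriv v1 s)]
    simp
  have hinner (i j : Fin n) (t : ℝ) (ht : t ∈ I) :
      inner ℝ (v i t) (v j t) = if i = j then 1 else 0 := by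
    rw [hI.eq_of_hasDerivAt_zero (f := fun t => inner ℝ (v i t) (v j t)) (fun s hs => ?_) ht₀ ht,
      hv₀, hv₀, (horth t₀ ht₀).2.2]
    refine ((hv i s).inner ℝ (hv j s)).congr_deriv ?_
    rw [inner_smul_left, inner_smul_right, hperp i s hs, real_inner_comm _ (v1 s), hperp j s hs]
    simp
  refine ⟨v, fun j => ?_, fun t ht => ⟨(horth t ht).1, fun j => hperp j t ht,
    fun i j => hinner i j t ht⟩, hv₀, fun j t _ => ⟨_, (hv j t).deriv⟩⟩
  refine contDiff_one_iff_deriv.2 ⟨fun t => (hv j t).differentiableAt, ?_⟩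
  rw [funext fun t => (hv j t).deriv]
  exact (hd1.inner (𝕜 := ℝ) (hv_cont j)).neg.smul hv1.continuous
end

section
/- Let n ≥ 2, k ∈ ℝ, let I ⊆ ℝ be an interval containing 0, let h : I → (0,∞) be C¹, and let b₀ ∈ ℝ. Define φ(t) = 1 + b₀ ∫₀ᵗ h(0)^{2k} / ((n−1) h(s)^{2k}) ds, and on the maximal subinterval J ⊆ I containing 0 on which φ > 0 define b̄(t) = (h(0)^{2k} / h(t)^{2k}) · b₀ / φ(t). Then b̄ is differentiable on J, b̄(0) = b₀, and b̄ satisfies the Riccati equation b̄'(t) = −b̄(t)²/(n−1) − 2k (h'(t)/h(t)) b̄(t) for all t ∈ J. -/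
open Set intervalIntegral

/-- **Explicit solution of the Riccati equation** `b' = −b²/(n−1) − 2k (h'/h) b`.
With `φ(t) = 1 + b₀ ∫₀ᵗ h(0)^{2k}/((n−1) h(s)^{2k}) ds`, and `J` the maximal subinterval of
`I` containing `0` on which `φ > 0`, the function
`b̄(t) = (h(0)^{2k}/h(t)^{2k}) · b₀ / φ(t)` satisfies `b̄(0) = b₀` and solves the
Riccati equation on `J`. -/
theorem riccati_explicit_solution (n : ℕ) (hn : 2 ≤ n) (k : ℝ)
    (I : Set ℝ) (hI : I.OrdConnected) (h0I : (0:ℝ) ∈ I)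
    (h : ℝ → ℝ) (hh : ContDiff ℝ 1 h) (hpos : ∀ t ∈ I, 0 < h t)
    (b₀ : ℝ) (φ bb : ℝ → ℝ) (J : Set ℝ)
    (hφ : ∀ t, φ t = 1 + b₀ * ∫ s in (0:ℝ)..t,
      (h 0) ^ (2 * k) / (((n:ℝ) - 1) * (h s) ^ (2 * k)))
    (hJ : J = {t ∈ I | ∀ s ∈ Set.uIcc (0:ℝ) t, 0 < φ s})
    (hbb : ∀ t, bb t = ((h 0) ^ (2 * k) / (h t) ^ (2 * k)) * b₀ / φ t) :
    bb 0 = b₀ ∧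
      ∀ t ∈ J, HasDerivWithinAt bb
        (-(bb t) ^ 2 / ((n:ℝ) - 1) - 2 * k * (deriv h t / h t) * bb t) J t := by
  have hn1 : (n : ℝ) - 1 ≠ 0 := by
    have : (2 : ℝ) ≤ n := by exact_mod_cast hn
    linarith
  refine ⟨?_, fun t ht => HasDerivAt.hasDerivWithinAt ?_⟩
  · have h0 : (h 0) ^ (2 * k) ≠ 0 := (Real.rpow_pos_of_pos (hpos 0 h0I) _).ne'
    simp [hbb, hφ, h0]
  rw [hJ] at ht
  obtain ⟨htI, hφpos⟩ := ht
  have hφt : φ t ≠ 0 := (hφpos t right_mem_uIcc).ne'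
  have hht : 0 < h t := hpos t htI
  have hHt : (h t) ^ (2 * k) ≠ 0 := (Real.rpow_pos_of_pos hht _).ne'
  have hcont : ∀ s ∈ I, ContinuousAt
      (fun s => (h 0) ^ (2 * k) / (((n:ℝ) - 1) * (h s) ^ (2 * k))) s := fun s hs =>
    continuousAt_const.div
      (continuousAt_const.mul (hh.continuous.continuousAt.rpow_const (Or.inl (hpos s hs).ne')))
      (mul_ne_zero hn1 (Real.rpow_pos_of_pos (hpos s hs) _).ne')
  have hmeas : Measurable
      (fun s => (h 0) ^ (2 * k) / (((n:ℝ) - 1) * (h s) ^ (2 * k))) :=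
    measurable_const.div (measurable_const.mul (hh.continuous.measurable.pow_const _))
  have hφ' : HasDerivAt φ
      (b₀ * ((h 0) ^ (2 * k) / (((n:ℝ) - 1) * (h t) ^ (2 * k)))) t := by
    rw [funext hφ]
    refine ((integral_hasDerivAt_right (ContinuousOn.intervalIntegrable fun s hs => ?_)
      hmeas.stronglyMeasurable.stronglyMeasurableAtFilter (hcont t htI)).const_mul b₀).const_add 1
    exact (hcont s (hI.uIcc_subset h0I htI hs)).continuousWithinAt
  have hH' : HasDerivAt (fun s => (h s) ^ (2 * k))
      (2 * k * (deriv h t / h t) * (h t) ^ (2 * k)) t := by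
    convert (hh.differentiable one_ne_zero t).hasDerivAt.rpow_const (p := 2 * k)
      (Or.inl hht.ne') using 1
    rw [Real.rpow_sub_one hht.ne']
    ring
  rw [hbb t, funext hbb]
  refine ((((hasDerivAt_const t ((h 0) ^ (2 * k))).div hH' hHt).mul_const b₀).div
    hφ' hφt).congr_deriv ?_
  simp only [Pi.div_apply]
  field_simp
  ring
end

section
/- Let n ≥ 2, k ∈ ℝ, and let h : [0,∞) → (0,∞) be a C¹ function with ∫₀^∞ h(s)^{−2k} ds = ∞. Suppose b : [0,∞) → ℝ is differentiable and satisfies the differential inequality b'(t) ≤ −b(t)²/(n−1) − 2k (h'(t)/h(t)) b(t) for all t ≥ 0. Then b(0) ≥ 0. -/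
open Set MeasureTheory

/-- A continuous function that is nonnegative on `[0, ∞)` and has bounded integrals over the
intervals `[0, T]` has finite integral over `[0, ∞)`. -/
lemma lintegral_Ici_ne_top_of_intervalIntegral_le {φ : ℝ → ℝ} {C : ℝ}
    (hφ : ContinuousOn φ (Ici 0)) (hφ0 : ∀ t, 0 ≤ t → 0 ≤ φ t)
    (hC : ∀ T, 0 ≤ T → ∫ s in (0:ℝ)..T, φ s ≤ C) :
    ∫⁻ s in Ici (0:ℝ), ENNReal.ofReal (φ s) ≠ ⊤ := by
  have hint : IntegrableOn φ (Ioi 0) := by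
    refine integrableOn_Ioi_of_intervalIntegral_norm_bounded C 0 (l := Filter.atTop) (b := id)
      (fun T => ?_) Filter.tendsto_id ?_
    · exact ((hφ.mono Icc_subset_Ici_self).integrableOn_Icc).mono_set Ioc_subset_Icc_self
    · filter_upwards [Filter.eventually_ge_atTop 0] with T hT
      refine le_of_eq_of_le (intervalIntegral.integral_congr fun s hs => ?_) (hC T hT)
      rw [id, uIcc_of_le hT] at hs
      exact Real.norm_of_nonneg (hφ0 s hs.1)
  rw [setLIntegral_congr Ioi_ae_eq_Ici.symm]
  exact hint.lintegral_lt_top.ne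

/-- A function with `u' ≤ -φ u² / m` for some `φ ≥ 0` with infinite integral over `[0, ∞)` cannot
start from a negative value. -/
lemma nonneg_of_deriv_le_neg_mul_sq {φ u u' : ℝ → ℝ} {m : ℝ} (hm : 0 < m)
    (hφ : ContinuousOn φ (Ici 0)) (hφ0 : ∀ t, 0 ≤ t → 0 ≤ φ t)
    (hdiv : ∫⁻ s in Ici (0:ℝ), ENNReal.ofReal (φ s) = ⊤)
    (hu : ∀ t, 0 ≤ t → HasDerivWithinAt u (u' t) (Ici 0) t)
    (hineq : ∀ t, 0 ≤ t → u' t ≤ -(φ t * u t ^ 2) / m) : 0 ≤ u 0 := by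
  by_contra! hu0
  have hneg : ∀ t, 0 ≤ t → u t < 0 := by
    have hanti : AntitoneOn u (Ici 0) := by
      refine antitoneOn_of_hasDerivWithinAt_nonpos (convex_Ici 0)
        (fun t ht => (hu t ht).continuousWithinAt)
        (fun t ht => (hu t (interior_subset ht)).mono interior_subset) fun t ht => ?_
      have ht0 : 0 ≤ t := interior_subset ht
      have := mul_nonneg (hφ0 t ht0) (sq_nonneg (u t))
      exact (hineq t ht0).trans (div_nonpos_of_nonpos_of_nonneg (by linarith) hm.le)
    exact fun t ht => (hanti self_mem_Ici ht ht).trans_lt hu0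
  have hv : ∀ t, 0 ≤ t →
      HasDerivWithinAt (fun s => m * (u s)⁻¹) (m * (-u' t / u t ^ 2)) (Ici 0) t :=
    fun t ht => ((hu t ht).fun_inv (hneg t ht).ne).const_mul m
  refine lintegral_Ici_ne_top_of_intervalIntegral_le (C := -(m * (u 0)⁻¹)) hφ hφ0
    (fun T hT => ?_) hdiv
  have hle := intervalIntegral.integral_le_sub_of_hasDeriv_right_of_le hT
    (fun t ht => ((hv t ht.1).mono Icc_subset_Ici_self).continuousWithinAt)
    (fun t ht => (hv t ht.1.le).mono (Ioi_subset_Ici ht.1.le))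
    (hφ.mono Icc_subset_Ici_self).integrableOn_Icc (fun t ht => by
      have hsq : 0 < u t ^ 2 := sq_pos_of_neg (hneg t ht.1.le)
      have := hineq t ht.1.le
      rw [le_div_iff₀ hm] at this
      rw [← mul_div_assoc, le_div_iff₀ hsq]
      linarith)
  have hT0 : m * (u T)⁻¹ ≤ 0 :=
    mul_nonpos_of_nonneg_of_nonpos hm.le (inv_nonpos.2 (hneg T hT).le)
  linarith

/-- **Riccati comparison.** If `b` satisfies the differential inequality
`b' ≤ −b²/(n−1) − 2k (h'/h) b` on `[0,∞)` for a positive `C¹` function `h` with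
`∫₀^∞ h(s)^{−2k} ds = ∞`, then `b(0) ≥ 0`. -/
theorem riccati_comparison_nonneg (n : ℕ) (hn : 2 ≤ n) (k : ℝ)
    (h : ℝ → ℝ) (hh : ContDiff ℝ 1 h) (hpos : ∀ t, 0 ≤ t → 0 < h t)
    (hdiv : ∫⁻ s in Set.Ici (0:ℝ), ENNReal.ofReal ((h s) ^ (-(2 * k))) = ⊤)
    (b b' : ℝ → ℝ)
    (hb : ∀ t, 0 ≤ t → HasDerivWithinAt b (b' t) (Set.Ici 0) t)
    (hineq : ∀ t, 0 ≤ t →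
      b' t ≤ -(b t) ^ 2 / ((n:ℝ) - 1) - 2 * k * (deriv h t / h t) * b t) :
    0 ≤ b 0 := by
  have hm : (0:ℝ) < (n:ℝ) - 1 := by
    have : (2:ℝ) ≤ n := by exact_mod_cast hn
    linarith
  have hu : ∀ t, 0 ≤ t → HasDerivWithinAt (fun s => h s ^ (2 * k) * b s)
      (deriv h t * (2 * k) * h t ^ (2 * k - 1) * b t + h t ^ (2 * k) * b' t) (Ici 0) t :=
    fun t ht => (((hh.differentiable one_ne_zero t).hasDerivAt.rpow_const
      (Or.inl (hpos t ht).ne')).hasDerivWithinAt).fun_mul (hb t ht)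
  have hu0 : 0 ≤ h 0 ^ (2 * k) * b 0 := by
    refine nonneg_of_deriv_le_neg_mul_sq hm
      (hh.continuous.continuousOn.rpow_const fun t ht => Or.inl (hpos t ht).ne')
      (fun t ht => Real.rpow_nonneg (hpos t ht).le _) hdiv hu fun t ht => ?_
    have hp : 0 < h t ^ (2 * k) := Real.rpow_pos_of_pos (hpos t ht) _
    have hmul := mul_le_mul_of_nonneg_left (hineq t ht) hp.le
    rw [Real.rpow_sub_one (hpos t ht).ne', Real.rpow_neg (hpos t ht).le]
    have hsq : (h t ^ (2 * k))⁻¹ * (h t ^ (2 * k) * b t) ^ 2 = h t ^ (2 * k) * b t ^ 2 := by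
      field_simp
    rw [hsq]
    linear_combination hmul
  exact nonneg_of_mul_nonneg_right hu0 (Real.rpow_pos_of_pos (hpos 0 le_rfl) _)
end

section
/- Let n > 2 and λ > 0, and set a = √(λ/(n−2)). Let I ⊆ ℝ be an interval containing 0 and let u : I → ℝ be a C² function satisfying u''(t) = −λ + u'(t)²/(n−2) for all t ∈ I. Then cosh(a t) − (u'(0)/√(λ(n−2))) sinh(a t) > 0 for all t ∈ I, and u(t) = u(0) − (n−2) log( cosh(a t) − (u'(0)/√(λ(n−2))) sinh(a t) ) for all t ∈ I. Equivalently, e^{u(t)} = e^{u(0)} ( cosh(a t) − (u'(0)/√(λ(n−2))) sinh(a t) )^{−(n−2)}. -/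
open Set Real

/-- A solution of `g' = c g` on an interval containing `0` is `g 0 * exp (c t)`. -/
theorem eq_mul_exp_of_hasDerivAt_mul {I : Set ℝ} (hI : I.OrdConnected) (h0 : (0 : ℝ) ∈ I)
    {g : ℝ → ℝ} {c : ℝ} (hg : ∀ t ∈ I, HasDerivAt g (c * g t) t) {t : ℝ} (ht : t ∈ I) :
    g t = g 0 * Real.exp (c * t) := by
  have hderiv : ∀ s ∈ I,
      HasDerivWithinAt (fun s => g s * Real.exp (-(c * s))) 0 I s := by
    intro s hs
    have hexp : HasDerivAt (fun s => Real.exp (-(c * s))) (Real.exp (-(c * s)) * -(c * 1)) s :=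
      ((hasDerivAt_id s).const_mul c).neg.exp
    exact (((hg s hs).mul hexp).congr_deriv (by ring)).hasDerivWithinAt
  have hconst := hI.convex.norm_image_sub_le_of_norm_hasDerivWithin_le (C := 0) hderiv
    (fun _ _ => by simp) h0 ht
  have heq : g t * Real.exp (-(c * t)) = g 0 := by
    simpa [sub_eq_zero] using hconst
  rw [← heq, mul_assoc, ← Real.exp_add, neg_add_cancel, Real.exp_zero, mul_one]

/-- The explicit solution of `f'' = a² f` on an interval containing `0`. -/
theorem mul_eq_cosh_add_sinh_of_hasDerivAt {I : Set ℝ} (hI : I.OrdConnected) (h0 : (0 : ℝ) ∈ I)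
    {f f' : ℝ → ℝ} {a : ℝ} (hf : ∀ t ∈ I, HasDerivAt f (f' t) t)
    (hf' : ∀ t ∈ I, HasDerivAt f' (a ^ 2 * f t) t) {t : ℝ} (ht : t ∈ I) :
    a * f t = a * f 0 * Real.cosh (a * t) + f' 0 * Real.sinh (a * t) := by
  have hadd := eq_mul_exp_of_hasDerivAt_mul hI h0 (g := fun s => f' s + a * f s) (c := a)
    (fun s hs => ((hf' s hs).add ((hf s hs).const_mul a)).congr_deriv (by ring)) ht
  have hsub := eq_mul_exp_of_hasDerivAt_mul hI h0 (g := fun s => f' s - a * f s) (c := -a)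
    (fun s hs => ((hf' s hs).sub ((hf s hs).const_mul a)).congr_deriv (by ring)) ht
  rw [neg_mul] at hsub
  rw [Real.cosh_eq, Real.sinh_eq]
  linear_combination (hadd - hsub) / 2

/-- **Explicit integration of** `u'' = −λ + (u')²/(n−2)`.
With `a = √(λ/(n−2))`, any `C²` solution on an interval `I` containing `0` satisfies
`cosh(a t) − (u'(0)/√(λ(n−2))) sinh(a t) > 0` on `I` and
`u(t) = u(0) − (n−2) log(cosh(a t) − (u'(0)/√(λ(n−2))) sinh(a t))`; equivalently,
`e^{u(t)} = e^{u(0)} (cosh(a t) − (u'(0)/√(λ(n−2))) sinh(a t))^{−(n−2)}`. -/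
theorem log_eigen_ode_explicit (n : ℕ) (hn : 2 < n) (lam : ℝ) (hlam : 0 < lam)
    (I : Set ℝ) (hI : I.OrdConnected) (h0I : (0:ℝ) ∈ I)
    (u : ℝ → ℝ) (hu : ContDiff ℝ 2 u)
    (hode : ∀ t ∈ I, deriv (deriv u) t = -lam + (deriv u t) ^ 2 / ((n:ℝ) - 2)) :
    ∀ t ∈ I,
      0 < Real.cosh (Real.sqrt (lam / ((n:ℝ) - 2)) * t) -
          (deriv u 0 / Real.sqrt (lam * ((n:ℝ) - 2))) *
            Real.sinh (Real.sqrt (lam / ((n:ℝ) - 2)) * t) ∧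
      u t = u 0 - ((n:ℝ) - 2) *
          Real.log (Real.cosh (Real.sqrt (lam / ((n:ℝ) - 2)) * t) -
            (deriv u 0 / Real.sqrt (lam * ((n:ℝ) - 2))) *
              Real.sinh (Real.sqrt (lam / ((n:ℝ) - 2)) * t)) ∧
      Real.exp (u t) = Real.exp (u 0) *
          (Real.cosh (Real.sqrt (lam / ((n:ℝ) - 2)) * t) -
            (deriv u 0 / Real.sqrt (lam * ((n:ℝ) - 2))) *
              Real.sinh (Real.sqrt (lam / ((n:ℝ) - 2)) * t)) ^ (-((n:ℝ) - 2)) := by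
  intro t ht
  have hm : (0 : ℝ) < (n : ℝ) - 2 := by
    have : (2 : ℝ) < n := by exact_mod_cast hn
    linarith
  generalize (n : ℝ) - 2 = m at *
  have hapos : 0 < Real.sqrt (lam / m) := Real.sqrt_pos.mpr (div_pos hlam hm)
  have hasq : Real.sqrt (lam / m) ^ 2 = lam / m := Real.sq_sqrt (div_pos hlam hm).le
  have hsqrt : Real.sqrt (lam * m) = m * Real.sqrt (lam / m) := by
    rw [show lam * m = m ^ 2 * (lam / m) by field_simp, Real.sqrt_mul (sq_nonneg m),
      Real.sqrt_sq hm.le]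
  rw [hsqrt]
  generalize Real.sqrt (lam / m) = a at *
  have hu1 : ∀ s, HasDerivAt u (deriv u s) s := fun s =>
    (hu.differentiable (by norm_num) s).hasDerivAt
  have hu2 : ∀ s, HasDerivAt (deriv u) (deriv (deriv u) s) s := fun s =>
    (hu.differentiable_deriv_two s).hasDerivAt
  have hw : ∀ s, HasDerivAt (fun s => Real.exp (-(u s - u 0) / m))
      (-deriv u s / m * Real.exp (-(u s - u 0) / m)) s := fun s =>
    (((hu1 s).sub_const (u 0)).neg.div_const m).exp.congr_deriv (mul_comm _ _)
  have hw' : ∀ s ∈ I, HasDerivAt (fun s => -deriv u s / m * Real.exp (-(u s - u 0) / m))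
      (a ^ 2 * Real.exp (-(u s - u 0) / m)) s := fun s hs =>
    (((hu2 s).neg.div_const m).mul (hw s)).congr_deriv (by
      simp only [Pi.neg_apply]
      rw [hasq, hode s hs]
      field_simp
      ring)
  have hsol := mul_eq_cosh_add_sinh_of_hasDerivAt hI h0I (fun s _ => hw s) hw' ht
  have hexp : Real.cosh (a * t) - deriv u 0 / (m * a) * Real.sinh (a * t) =
      Real.exp (-(u t - u 0) / m) := by
    apply mul_left_cancel₀ hapos.ne'
    rw [hsol]
    simp only [sub_self, neg_zero, zero_div, Real.exp_zero]
    field_simp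
    ring
  rw [hexp]
  refine ⟨Real.exp_pos _, ?_, ?_⟩
  · rw [Real.log_exp]
    field_simp
    ring
  · rw [← Real.exp_mul, ← Real.exp_add]
    congr 1
    field_simp
    ring
end

section
/- Let n > 2 and λ > 0. If u : ℝ → ℝ is a C² function defined on all of ℝ satisfying u''(t) = −λ + u'(t)²/(n−2) for all t ∈ ℝ, then u'(0)² ≤ λ(n−2). -/
open Real

/-- Solutions of `v' = a * v` on `ℝ` are exponentials. -/
theorem eq_mul_exp_of_hasDerivAt {v : ℝ → ℝ} {a : ℝ} (hv : ∀ t, HasDerivAt v (a * v t) t) (t : ℝ) :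
    v t = v 0 * exp (a * t) := by
  have hexp (s : ℝ) : HasDerivAt (fun s => exp (-(a * s))) (exp (-(a * s)) * -(a * 1)) s :=
    (((hasDerivAt_id s).const_mul a).neg).exp
  have hconst (s : ℝ) : HasDerivAt (fun s => v s * exp (-(a * s))) 0 s :=
    ((hv s).mul (hexp s)).congr_deriv (by ring)
  have h := is_const_of_deriv_eq_zero (fun s => (hconst s).differentiableAt)
    (fun s => (hconst s).deriv) t 0
  simp only [mul_zero, neg_zero, exp_zero, mul_one] at h
  rw [← h, mul_assoc, ← exp_add, neg_add_cancel, exp_zero, mul_one]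

/-- A positive global solution of `w'' = k² w` has `0 ≤ k * (w'(0) + k * w(0))`. -/
theorem mul_deriv_add_nonneg_of_pos {w w' : ℝ → ℝ} {k : ℝ} (hk : k ≠ 0)
    (hw : ∀ t, HasDerivAt w (w' t) t) (hw' : ∀ t, HasDerivAt w' (k ^ 2 * w t) t)
    (hpos : ∀ t, 0 < w t) : 0 ≤ k * (w' 0 + k * w 0) := by
  have hplus := eq_mul_exp_of_hasDerivAt (v := fun t => w' t + k * w t) (a := k) fun t =>
    ((hw' t).add ((hw t).const_mul k)).congr_deriv (by ring)
  have hminus := eq_mul_exp_of_hasDerivAt (v := fun t => w' t - k * w t) (a := -k) fun t =>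
    ((hw' t).sub ((hw t).const_mul k)).congr_deriv (by ring)
  by_contra! hneg
  set c := k * (w' 0 + k * w 0) with hc
  set d := k * (w' 0 - k * w 0) with hd
  have key (t : ℝ) : 0 < c * exp (2 * (k * t)) - d := by
    have hsol : 2 * k ^ 2 * w t = c * exp (k * t) - d * exp (-k * t) := by
      rw [hc, hd]
      linear_combination k * hplus t - k * hminus t
    have hcancel : exp (-k * t) * exp (k * t) = 1 := by
      rw [← exp_add, neg_mul, neg_add_cancel, exp_zero]
    have hsq : exp (2 * (k * t)) = exp (k * t) * exp (k * t) := by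
      rw [← exp_add, two_mul]
    have hprod : 0 < 2 * k ^ 2 * w t * exp (k * t) := by
      have := hpos t
      positivity
    have heq : 2 * k ^ 2 * w t * exp (k * t) = c * exp (2 * (k * t)) - d := by
      rw [hsq]
      linear_combination exp (k * t) * hsol - d * hcancel
    rwa [← heq]
  have h := key (d / c / (2 * k))
  have harg : 2 * (k * (d / c / (2 * k))) = d / c := by field_simp
  rw [harg] at h
  have hmul : c * exp (d / c) ≤ c * (d / c + 1) :=
    mul_le_mul_of_nonpos_left (add_one_le_exp _) hneg.le
  have hdiv : c * (d / c) = d := mul_div_cancel₀ d hneg.ne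
  linarith

/-- A positive global solution of `w'' = k² w` satisfies `w'(0)² ≤ k² w(0)²`. -/
theorem sq_deriv_le_of_pos {w w' : ℝ → ℝ} {k : ℝ} (hk : 0 < k)
    (hw : ∀ t, HasDerivAt w (w' t) t) (hw' : ∀ t, HasDerivAt w' (k ^ 2 * w t) t)
    (hpos : ∀ t, 0 < w t) : w' 0 ^ 2 ≤ (k * w 0) ^ 2 := by
  have hplus := mul_deriv_add_nonneg_of_pos hk.ne' hw hw' hpos
  have hminus := mul_deriv_add_nonneg_of_pos (neg_ne_zero.mpr hk.ne') hw
    (fun t => by simpa using hw' t) hpos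
  have hlow := nonneg_of_mul_nonneg_right hplus hk
  have hup : 0 ≤ k * w 0 - w' 0 := nonneg_of_mul_nonneg_right (by linarith) hk
  exact sq_le_sq' (by linarith) (by linarith)

/-- **Global solutions force the gradient bound.** If `u : ℝ → ℝ` is a `C²` solution of
`u'' = −λ + (u')²/(n−2)` on all of `ℝ` (with `n > 2`, `λ > 0`), then `u'(0)² ≤ λ(n−2)`. -/
theorem gradient_bound_of_global_solution (n : ℕ) (hn : 2 < n) (lam : ℝ) (hlam : 0 < lam)
    (u : ℝ → ℝ) (hu : ContDiff ℝ 2 u)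
    (hode : ∀ t : ℝ, deriv (deriv u) t = -lam + (deriv u t) ^ 2 / ((n:ℝ) - 2)) :
    (deriv u 0) ^ 2 ≤ lam * ((n:ℝ) - 2) := by
  set m : ℝ := (n : ℝ) - 2
  have hm : 0 < m := by
    have : (2 : ℝ) < n := by exact_mod_cast hn
    linarith
  have hu1 (t : ℝ) : HasDerivAt u (deriv u t) t :=
    (hu.differentiable (by norm_num) t).hasDerivAt
  have hu2 (t : ℝ) : HasDerivAt (deriv u) (-lam + deriv u t ^ 2 / m) t := by
    rw [← hode t]
    exact ((hu.iterate_deriv' 1 1).differentiable (by norm_num) t).hasDerivAt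
  have hk : 0 < √(lam / m) := sqrt_pos.mpr (by positivity)
  have hksq : √(lam / m) ^ 2 = lam / m := sq_sqrt (by positivity)
  have hw (t : ℝ) : HasDerivAt (fun t => exp (-u t / m))
      (exp (-u t / m) * (-deriv u t / m)) t := ((hu1 t).neg.div_const m).exp
  have hw' (t : ℝ) : HasDerivAt (fun t => exp (-u t / m) * (-deriv u t / m))
      (√(lam / m) ^ 2 * exp (-u t / m)) t := by
    refine ((hw t).mul ((hu2 t).neg.div_const m)).congr_deriv ?_
    rw [hksq]
    simp only [Pi.neg_apply]
    field_simp
    ring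
  have h := sq_deriv_le_of_pos hk hw hw' fun t => exp_pos _
  rw [mul_pow, mul_pow, hksq, mul_comm] at h
  have hle : (-deriv u 0 / m) ^ 2 ≤ lam / m := le_of_mul_le_mul_right h (by positivity)
  rw [div_pow, neg_sq, div_le_div_iff₀ (by positivity) hm] at hle
  exact le_of_mul_le_mul_right (by linarith [hle]) hm
end
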